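/- arXiv:1608.06880 — 10 statements merged into one kernel-verified Lean document; each statement's English description precedes it below -/
import Mathlib

section
/- Let n ≥ 2 be an integer. Define Θ_1 = {(k_1+1, k_2, …, k_{n−1}, 0) : (k_1, …, k_{n−1}) ∈ Θ^{k−1}_{n−1}} and Θ_2 = {(0, k_1, k_2, …, k_{n−k}, 0, …, 0) with k−1 trailing zeros : (k_1, …, k_{n−k}) ∈ Θ^k_{n−k}}. If 2 ≤ k ≤ ⌊n/2⌋, then Θ^k_n = Θ_1 ∪ Θ_2; and if ⌊n/2⌋ < k ≤ n, then Θ^k_n = Θ_1. -/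
/-- The partition set `Θ^k_n`: tuples `(k_1, …, k_n)` of nonnegative integers (encoded as
functions `ℕ → ℕ` supported on `{1, …, n}`) with `k_1 + ⋯ + k_n = k` and
`1·k_1 + 2·k_2 + ⋯ + n·k_n = n`. -/
def thetaSet (n k : ℕ) : Set (ℕ → ℕ) :=
  {v | (∀ j, j = 0 ∨ n < j → v j = 0) ∧
    (∑ j ∈ Finset.Icc 1 n, v j = k) ∧ (∑ j ∈ Finset.Icc 1 n, j * v j = n)}

/-- Membership in `thetaSet n k` can be tested with sums over any long enough range: the constraint
on the weighted sum forces the support to lie in `{1, …, n}`. -/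
theorem mem_thetaSet_iff_range {n k N : ℕ} (hN : n < N) (v : ℕ → ℕ) :
    v ∈ thetaSet n k ↔ v 0 = 0 ∧ (∀ j, N ≤ j → v j = 0) ∧
      ∑ j ∈ Finset.range N, v j = k ∧ ∑ j ∈ Finset.range N, j * v j = n := by
  have hsub : Finset.Icc 1 n ⊆ Finset.range N := fun j hj => by
    simp only [Finset.mem_Icc, Finset.mem_range] at *
    omega
  have key (hv : ∀ j, j = 0 ∨ n < j → v j = 0) :
      ∑ j ∈ Finset.Icc 1 n, v j = ∑ j ∈ Finset.range N, v j ∧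
        ∑ j ∈ Finset.Icc 1 n, j * v j = ∑ j ∈ Finset.range N, j * v j := by
    have hzero : ∀ j ∉ Finset.Icc 1 n, v j = 0 := fun j hj => hv j (by
      simp only [Finset.mem_Icc] at hj
      omega)
    exact ⟨Finset.sum_subset hsub fun j _ hj => hzero j hj,
      Finset.sum_subset hsub fun j _ hj => by rw [hzero j hj, mul_zero]⟩
  constructor
  · rintro ⟨hv, hk, hn⟩
    obtain ⟨h₁, h₂⟩ := key hv
    exact ⟨hv 0 (Or.inl rfl), fun j hj => hv j (Or.inr (by omega)), h₁ ▸ hk, h₂ ▸ hn⟩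
  · rintro ⟨h0, hv, hk, hn⟩
    have hsupp : ∀ j, j = 0 ∨ n < j → v j = 0 := by
      rintro j (rfl | hj)
      · exact h0
      · by_contra hne
        have hjN : j ∈ Finset.range N :=
          Finset.mem_range.2 (not_le.1 fun h => hne (hv j h))
        have hle := Finset.single_le_sum (f := fun j => j * v j) (fun _ _ => Nat.zero_le _) hjN
        have hmul := Nat.le_mul_of_pos_right j (Nat.pos_of_ne_zero hne)
        omega
    obtain ⟨h₁, h₂⟩ := key hsupp
    exact ⟨hsupp, h₁.trans hk, h₂.trans hn⟩

theorem thetaSet_eq_empty_of_lt {n k : ℕ} (h : n < k) : thetaSet n k = ∅ := by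
  refine Set.eq_empty_of_forall_notMem ?_
  rintro v ⟨-, hk, hn⟩
  have : ∑ j ∈ Finset.Icc 1 n, v j ≤ ∑ j ∈ Finset.Icc 1 n, j * v j :=
    Finset.sum_le_sum fun j hj => Nat.le_mul_of_pos_left _ (Finset.mem_Icc.1 hj).1
  omega

theorem update_mem_thetaSet_iff {n k : ℕ} (v : ℕ → ℕ) :
    Function.update v 1 (v 1 + 1) ∈ thetaSet (n + 1) (k + 1) ↔ v ∈ thetaSet n k := by
  rw [mem_thetaSet_iff_range (N := n + 2) (by omega),
    mem_thetaSet_iff_range (N := n + 2) (by omega)]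
  have hsupp : (∀ j, n + 2 ≤ j → Function.update v 1 (v 1 + 1) j = 0) ↔
      ∀ j, n + 2 ≤ j → v j = 0 :=
    forall₂_congr fun j hj => by rw [Function.update_of_ne (by omega)]
  rw [hsupp]
  simp only [Finset.sum_range_succ' _ (n + 1), Finset.sum_range_succ' _ n]
  simp
  omega

theorem shift_mem_thetaSet_iff {n k : ℕ} (hk : 0 < k) (hkn : k ≤ n) (v : ℕ → ℕ) :
    (fun j => if j = 0 then 0 else v (j - 1)) ∈ thetaSet n k ∧ v 0 = 0 ↔
      v ∈ thetaSet (n - k) k := by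
  rw [mem_thetaSet_iff_range (N := n + 1) (by omega),
    mem_thetaSet_iff_range (N := n) (by omega)]
  have hsupp : (∀ j, n + 1 ≤ j → (if j = 0 then 0 else v (j - 1)) = 0) ↔
      ∀ j, n ≤ j → v j = 0 := by
    refine ⟨fun h j hj => by simpa using h (j + 1) (by omega), fun h j hj => ?_⟩
    rw [if_neg (by omega), h _ (by omega)]
  rw [hsupp]
  simp only [Finset.sum_range_succ' _ n]
  simp [add_mul, Finset.sum_add_distrib]
  constructor
  · rintro ⟨⟨hv, hs, hw⟩, h0⟩
    exact ⟨h0, hv, hs, by omega⟩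
  · rintro ⟨h0, hv, hs, hw⟩
    exact ⟨⟨hv, hs, by omega⟩, h0⟩

theorem thetaSet_succ_eq_union {n k : ℕ} (hkn : k ≤ n) :
    thetaSet (n + 1) (k + 1) =
      ((fun v => Function.update v 1 (v 1 + 1)) '' thetaSet n k) ∪
      ((fun v => fun j => if j = 0 then 0 else v (j - 1)) ''
        thetaSet (n + 1 - (k + 1)) (k + 1)) := by
  ext w
  constructor
  · intro hw
    rcases Nat.eq_zero_or_pos (w 1) with h1 | h1
    · right
      have hshift : (fun j => if j = 0 then 0 else w (j - 1 + 1)) = w := by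
        ext j
        rcases j with _ | j
        · simp [hw.1 0 (Or.inl rfl)]
        · simp
      exact ⟨fun j => w (j + 1),
        (shift_mem_thetaSet_iff (by omega) (by omega) _).1 ⟨hshift.symm ▸ hw, h1⟩, hshift⟩
    · left
      have hupd : Function.update (Function.update w 1 (w 1 - 1)) 1
          (Function.update w 1 (w 1 - 1) 1 + 1) = w := by
        simp [Nat.sub_add_cancel h1]
      exact ⟨Function.update w 1 (w 1 - 1),
        (update_mem_thetaSet_iff _).1 (hupd.symm ▸ hw), hupd⟩
  · rintro (⟨v, hv, rfl⟩ | ⟨v, hv, rfl⟩)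
    · exact (update_mem_thetaSet_iff v).2 hv
    · exact ((shift_mem_thetaSet_iff (by omega) (by omega) v).2 hv).1

/-- Recurrence for the partition sets `Θ^k_n`, `n ≥ 2`:  with
`Θ_1 = {(k_1+1, k_2, …, k_{n-1}, 0) : (k_1, …, k_{n-1}) ∈ Θ^{k-1}_{n-1}}` and
`Θ_2 = {(0, k_1, …, k_{n-k}, 0, …, 0) : (k_1, …, k_{n-k}) ∈ Θ^k_{n-k}}` (with `k - 1`
trailing zeros), one has `Θ^k_n = Θ_1 ∪ Θ_2` for `2 ≤ k ≤ ⌊n/2⌋`, and `Θ^k_n = Θ_1` for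
`⌊n/2⌋ < k ≤ n`. -/
theorem theta_recurrence (n k : ℕ) (hn : 2 ≤ n) :
    (2 ≤ k → k ≤ n / 2 →
      thetaSet n k =
        ((fun v => Function.update v 1 (v 1 + 1)) '' thetaSet (n - 1) (k - 1)) ∪
        ((fun v => fun j => if j = 0 then 0 else v (j - 1)) '' thetaSet (n - k) k)) ∧
    (n / 2 < k → k ≤ n →
      thetaSet n k =
        (fun v => Function.update v 1 (v 1 + 1)) '' thetaSet (n - 1) (k - 1)) := by
  have hunion (hk : 0 < k) (hkn : k ≤ n) :=
    thetaSet_succ_eq_union (n := n - 1) (k := k - 1) (by omega)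
  simp only [Nat.sub_add_cancel (by omega : 1 ≤ n)] at hunion
  refine ⟨fun hk hkn => ?_, fun hk hkn => ?_⟩
  · simpa only [Nat.sub_add_cancel (by omega : 1 ≤ k)] using hunion (by omega) (by omega)
  · have h := hunion (by omega) hkn
    rwa [Nat.sub_add_cancel (by omega : 1 ≤ k), thetaSet_eq_empty_of_lt (n := n - k) (by omega),
      Set.image_empty, Set.union_empty] at h
end

section
/- Let N : ℝ → ℝ be a smooth function, n ≥ 1 an integer, and u_0, u_1, …, u_n real numbers. Then the n-th Adomian polynomial of N satisfies A_n(u_0, u_1, …, u_n) = (1/n!) Σ_{k=1}^{n} B_{n,k}(1!·u_1, 2!·u_2, …, (n−k+1)!·u_{n−k+1}) · N^{(k)}(u_0), where N^{(k)} denotes the k-th derivative of N. -/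
/-- The partition set `Λ^k_n` as a finset: functions `ℕ → ℕ` supported on `{1, …, n-k+1}`
with `k_1 + ⋯ + k_{n-k+1} = k` and `1·k_1 + 2·k_2 + ⋯ + (n-k+1)·k_{n-k+1} = n`. -/
def lambdaSet (n k : ℕ) : Finset (ℕ → ℕ) :=
  (Finset.piAntidiag (Finset.Icc 1 (n - k + 1)) k).filter
    (fun v => ∑ j ∈ Finset.Icc 1 (n - k + 1), j * v j = n)

/-- The partial exponential Bell polynomial
`B_{n,k}(u_1, …, u_{n-k+1}) = n! Σ_{Λ^k_n} Π_j (1/k_j!) (u_j/j!)^{k_j}`. -/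
noncomputable def bellB (n k : ℕ) (u : ℕ → ℝ) : ℝ :=
  (Nat.factorial n : ℝ) * ∑ v ∈ lambdaSet n k, ∏ j ∈ Finset.Icc 1 (n - k + 1),
    (1 / (Nat.factorial (v j) : ℝ)) * (u j / (Nat.factorial j : ℝ)) ^ (v j)

/-- The partial ordinary Bell polynomial
`B̂_{n,k}(u_1, …, u_{n-k+1}) = k! Σ_{Λ^k_n} Π_j u_j^{k_j}/k_j!`. -/
noncomputable def bellBhat (n k : ℕ) (u : ℕ → ℝ) : ℝ :=
  (Nat.factorial k : ℝ) * ∑ v ∈ lambdaSet n k, ∏ j ∈ Finset.Icc 1 (n - k + 1),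
    (u j) ^ (v j) / (Nat.factorial (v j) : ℝ)

/-- The `n`-th Adomian polynomial of `N`:
`A_n(u_0, …, u_n) = (1/n!) (d/dλ)^n N(u_0 + u_1 λ + ⋯ + u_n λ^n) |_{λ=0}`. -/
noncomputable def adomian (N : ℝ → ℝ) (n : ℕ) (u : ℕ → ℝ) : ℝ :=
  (1 / (Nat.factorial n : ℝ)) *
    iteratedDeriv n (fun l : ℝ => N (∑ i ∈ Finset.range (n + 1), u i * l ^ i)) 0

open Polynomial in
/-- The `n`-th derivative of `N ∘ p` is a combination of the `N⁽ᵏ⁾ ∘ p` whose coefficients are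
polynomials that do not depend on `N`. -/
lemma exists_iteratedDeriv_comp_polynomial (p : ℝ[X]) (n : ℕ) :
    ∃ Q : ℕ → ℝ[X], ∀ N : ℝ → ℝ, ContDiff ℝ (⊤ : ℕ∞) N → ∀ x : ℝ,
      iteratedDeriv n (fun l => N (p.eval l)) x =
        ∑ k ∈ Finset.range (n + 1), iteratedDeriv k N (p.eval x) * (Q k).eval x := by
  induction n with
  | zero => exact ⟨fun _ => 1, fun N _ x => by simp⟩
  | succ n ih =>
    obtain ⟨Q, hQ⟩ := ih
    refine ⟨fun k => (if k = 0 then 0 else Q (k - 1) * derivative p) +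
      (if k = n + 1 then 0 else derivative (Q k)), fun N hN x => ?_⟩
    rw [iteratedDeriv_succ, funext (hQ N hN)]
    have hd (k : ℕ) : HasDerivAt (fun l => iteratedDeriv k N (p.eval l) * (Q k).eval l)
        (iteratedDeriv (k + 1) N (p.eval x) * (derivative p).eval x * (Q k).eval x +
          iteratedDeriv k N (p.eval x) * (derivative (Q k)).eval x) x := by
      have h1 : HasDerivAt (iteratedDeriv k N) (iteratedDeriv (k + 1) N (p.eval x)) (p.eval x) := by
        rw [iteratedDeriv_succ]
        exact ((hN.differentiable_iteratedDeriv k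
          (by exact_mod_cast WithTop.coe_lt_top k)) _).hasDerivAt
      exact (h1.comp x (p.hasDerivAt x)).mul ((Q k).hasDerivAt x)
    rw [(HasDerivAt.fun_sum fun k _ => hd k).deriv, Finset.sum_add_distrib]
    simp only [eval_add, mul_add, Finset.sum_add_distrib]
    congr 1
    · rw [Finset.sum_range_succ' _ (n + 1)]
      simp [mul_left_comm, mul_comm]
    · rw [Finset.sum_range_succ _ (n + 1)]
      simp only [if_true, eval_zero, mul_zero, add_zero]
      refine Finset.sum_congr rfl fun k hk => ?_
      rw [if_neg (Finset.mem_range.mp hk).ne]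

open Polynomial in
lemma iteratedDeriv_polynomial_eval (p : ℝ[X]) (n : ℕ) :
    iteratedDeriv n (fun x => p.eval x) = fun x => (derivative^[n] p).eval x := by
  induction n with
  | zero => simp
  | succ n ih =>
    rw [iteratedDeriv_succ, ih, Function.iterate_succ_apply']
    ext x
    exact Polynomial.deriv _

open Polynomial in
lemma iteratedDeriv_polynomial_eval_zero (p : ℝ[X]) (n : ℕ) :
    iteratedDeriv n (fun x => p.eval x) 0 = n.factorial * p.coeff n := by
  rw [iteratedDeriv_polynomial_eval]
  simp [← coeff_zero_eq_eval_zero, coeff_iterate_derivative, Nat.descFactorial_self]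

open Polynomial in
lemma iteratedDeriv_sub_pow_self (a : ℝ) (j k : ℕ) :
    iteratedDeriv j (fun x : ℝ => (x - a) ^ k) a = if j = k then (k.factorial : ℝ) else 0 := by
  have h := iteratedDeriv_comp_sub_const j (fun x : ℝ => x ^ k) a
  have h0 := iteratedDeriv_polynomial_eval_zero (X ^ k) j
  simp only [eval_pow, eval_X, coeff_X_pow] at h0
  rw [h]
  simp only [sub_self, h0]
  split_ifs with hjk <;> simp [hjk]

open Polynomial in
/-- Faà di Bruno's formula at `0` for a polynomial inner function. -/
lemma iteratedDeriv_comp_polynomial_zero (p : ℝ[X]) (N : ℝ → ℝ) (hN : ContDiff ℝ (⊤ : ℕ∞) N)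
    (n : ℕ) :
    iteratedDeriv n (fun l => N (p.eval l)) 0 = ∑ k ∈ Finset.range (n + 1),
      n.factorial / k.factorial * ((p - C (p.eval 0)) ^ k).coeff n *
        iteratedDeriv k N (p.eval 0) := by
  obtain ⟨Q, hQ⟩ := exists_iteratedDeriv_comp_polynomial p n
  rw [hQ N hN]
  refine Finset.sum_congr rfl fun k hk => ?_
  have h := hQ (fun x => (x - p.eval 0) ^ k) (by fun_prop) 0
  simp only [iteratedDeriv_sub_pow_self, ite_mul, zero_mul, Finset.sum_ite_eq', hk, if_true] at h
  have h2 := iteratedDeriv_polynomial_eval_zero ((p - C (p.eval 0)) ^ k) n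
  simp only [eval_pow, eval_sub, eval_C] at h2
  rw [h2] at h
  have hk0 : (k.factorial : ℝ) ≠ 0 := by positivity
  field_simp
  linear_combination -iteratedDeriv k N (p.eval 0) * h

lemma lambdaSet_eq_filter_piAntidiag_Icc {n k : ℕ} (hk : 1 ≤ k) (hkn : k ≤ n) :
    lambdaSet n k = (Finset.piAntidiag (Finset.Icc 1 n) k).filter
      (fun v => ∑ j ∈ Finset.Icc 1 n, j * v j = n) := by
  have hsub : Finset.Icc 1 (n - k + 1) ⊆ Finset.Icc 1 n :=
    Finset.Icc_subset_Icc_right (by omega)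
  ext v
  simp only [lambdaSet, Finset.mem_filter, Finset.mem_piAntidiag]
  constructor
  · rintro ⟨⟨hs, hv⟩, hw⟩
    have h0 : ∀ j ∈ Finset.Icc 1 n, j ∉ Finset.Icc 1 (n - k + 1) → v j = 0 :=
      fun j _ hj => by_contra fun h => hj (hv j h)
    refine ⟨⟨?_, fun j hj => hsub (hv j hj)⟩, ?_⟩
    · rw [← hs, Finset.sum_subset hsub h0]
    · rw [← Finset.sum_subset hsub fun j hj hj' => by rw [h0 j hj hj', mul_zero], hw]
  · rintro ⟨⟨hs, hv⟩, hw⟩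
    have hv' : ∀ j, v j ≠ 0 → j ∈ Finset.Icc 1 (n - k + 1) := by
      intro j hj
      have hjn := hv j hj
      have hle : (j - 1) * v j ≤ ∑ i ∈ Finset.Icc 1 n, (i - 1) * v i :=
        Finset.single_le_sum (f := fun i => (i - 1) * v i) (fun _ _ => Nat.zero_le _) hjn
      have hsum : ∑ i ∈ Finset.Icc 1 n, (i - 1) * v i + k = n := by
        rw [← hs, ← Finset.sum_add_distrib, ← hw]
        refine Finset.sum_congr (by rw [hw]) fun i hi => ?_
        obtain ⟨i, rfl⟩ := Nat.exists_eq_add_of_le' (Finset.mem_Icc.mp hi).1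
        simp [add_mul]
      have : j - 1 ≤ (j - 1) * v j := Nat.le_mul_of_pos_right _ (Nat.pos_of_ne_zero hj)
      rw [Finset.mem_Icc] at hjn ⊢
      omega
    have h0 : ∀ j ∈ Finset.Icc 1 n, j ∉ Finset.Icc 1 (n - k + 1) → v j = 0 :=
      fun j _ hj => by_contra fun h => hj (hv' j h)
    refine ⟨⟨?_, hv'⟩, ?_⟩
    · exact (Finset.sum_subset hsub h0).trans hs
    · rw [Finset.sum_subset hsub fun j hj hj' => by rw [h0 j hj hj', mul_zero], hw]

open Polynomial in
lemma bellB_factorial_mul (u : ℕ → ℝ) {n k : ℕ} (hk : 1 ≤ k) (hkn : k ≤ n) :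
    bellB n k (fun j => (Nat.factorial j : ℝ) * u j) =
      n.factorial / k.factorial *
        ((∑ j ∈ Finset.Icc 1 n, C (u j) * X ^ j) ^ k : ℝ[X]).coeff n := by
  have hsub : Finset.Icc 1 (n - k + 1) ⊆ Finset.Icc 1 n :=
    Finset.Icc_subset_Icc_right (by omega)
  rw [bellB, div_mul_eq_mul_div, mul_div_assoc, Finset.sum_pow_eq_sum_piAntidiag,
    finsetSum_coeff]
  congr 1
  have hterm (v : ℕ → ℕ) : ((Nat.multinomial (Finset.Icc 1 n) v : ℝ[X]) *
      ∏ j ∈ Finset.Icc 1 n, (C (u j) * X ^ j) ^ v j).coeff n =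
      if ∑ j ∈ Finset.Icc 1 n, j * v j = n then
        (Nat.multinomial (Finset.Icc 1 n) v : ℝ) * ∏ j ∈ Finset.Icc 1 n, u j ^ v j else 0 := by
    have : (Nat.multinomial (Finset.Icc 1 n) v : ℝ[X]) *
        ∏ j ∈ Finset.Icc 1 n, (C (u j) * X ^ j) ^ v j =
        C ((Nat.multinomial (Finset.Icc 1 n) v : ℝ) * ∏ j ∈ Finset.Icc 1 n, u j ^ v j) *
          X ^ ∑ j ∈ Finset.Icc 1 n, j * v j := by
      simp only [mul_pow, Finset.prod_mul_distrib, ← pow_mul, Finset.prod_pow_eq_pow_sum,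
        C_mul, map_prod, C_pow, map_natCast, mul_assoc]
    rw [this, coeff_C_mul_X_pow]
    simp only [eq_comm]
  simp only [hterm]
  rw [← Finset.sum_filter, ← lambdaSet_eq_filter_piAntidiag_Icc hk hkn, Finset.sum_div]
  refine Finset.sum_congr rfl fun v hv => ?_
  have hv' := hv
  rw [lambdaSet_eq_filter_piAntidiag_Icc hk hkn, Finset.mem_filter, Finset.mem_piAntidiag] at hv'
  rw [lambdaSet, Finset.mem_filter, Finset.mem_piAntidiag] at hv
  have hm : (∏ j ∈ Finset.Icc 1 n, ((v j).factorial : ℝ)) *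
      Nat.multinomial (Finset.Icc 1 n) v = k.factorial := by
    rw [← hv'.1.1]
    exact_mod_cast Nat.multinomial_spec (Finset.Icc 1 n) v
  have hk0 : (k.factorial : ℝ) ≠ 0 := by positivity
  have hp0 : (∏ j ∈ Finset.Icc 1 n, ((v j).factorial : ℝ)) ≠ 0 :=
    Finset.prod_ne_zero_iff.mpr fun j _ => by positivity
  have hprod : ∏ j ∈ Finset.Icc 1 (n - k + 1), (1 / ((v j).factorial : ℝ)) *
      (j.factorial * u j / j.factorial) ^ v j =
      ∏ j ∈ Finset.Icc 1 n, (1 / ((v j).factorial : ℝ)) * u j ^ v j := by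
    rw [← Finset.prod_subset hsub]
    · refine Finset.prod_congr rfl fun j _ => ?_
      rw [mul_div_cancel_left₀ _ (by positivity)]
    · intro j _ hj
      have : v j = 0 := by_contra fun h => hj (hv.1.2 j h)
      simp [this]
  rw [hprod, Finset.prod_mul_distrib, eq_div_iff hk0, ← hm]
  simp only [one_div, Finset.prod_inv_distrib]
  field_simp

/-- For smooth `N : ℝ → ℝ` and `n ≥ 1`, the `n`-th Adomian polynomial of `N` is
`A_n(u_0, …, u_n) = (1/n!) Σ_{k=1}^{n} B_{n,k}(1!·u_1, …, (n-k+1)!·u_{n-k+1}) N^{(k)}(u_0)`. -/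
theorem adomian_eq_sum_bellB (N : ℝ → ℝ) (hN : ContDiff ℝ (⊤ : ℕ∞) N) (n : ℕ) (hn : 1 ≤ n)
    (u : ℕ → ℝ) :
    adomian N n u =
      (1 / (Nat.factorial n : ℝ)) * ∑ k ∈ Finset.Icc 1 n,
        bellB n k (fun j => (Nat.factorial j : ℝ) * u j) * iteratedDeriv k N (u 0) := by
  open Polynomial in
  set q : ℝ[X] := ∑ j ∈ Finset.Icc 1 n, C (u j) * X ^ j with hq
  have hrange : Finset.range (n + 1) = insert 0 (Finset.Icc 1 n) := by
    ext j
    simp only [Finset.mem_range, Finset.mem_insert, Finset.mem_Icc]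
    omega
  have hq0 : q.eval 0 = 0 := by
    rw [hq, eval_finsetSum]
    refine Finset.sum_eq_zero fun j hj => ?_
    have : j ≠ 0 := by rw [Finset.mem_Icc] at hj; omega
    simp [this]
  have heval (l : ℝ) : ∑ i ∈ Finset.range (n + 1), u i * l ^ i = (q + C (u 0)).eval l := by
    rw [hrange, Finset.sum_insert (by simp)]
    simp [hq, eval_finsetSum, add_comm]
  simp only [adomian, heval]
  rw [iteratedDeriv_comp_polynomial_zero _ N hN, hrange, Finset.sum_insert (by simp)]
  have hn0 : n ≠ 0 := by omega
  simp only [eval_add, eval_C, hq0, zero_add, add_sub_cancel_right, pow_zero, coeff_one, hn0,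
    if_false, mul_zero, zero_mul]
  congr 1
  refine Finset.sum_congr rfl fun k hk => ?_
  rw [bellB_factorial_mul u (Finset.mem_Icc.mp hk).1 (Finset.mem_Icc.mp hk).2]
end

section
/- Let N : ℝ → ℝ be a smooth function, n ≥ 1 an integer, and u_0, u_1, …, u_n real numbers. Then the n-th Adomian polynomial of N satisfies A_n(u_0, u_1, …, u_n) = Σ_{k=1}^{n} (1/k!) B̂_{n,k}(u_1, u_2, …, u_{n−k+1}) · N^{(k)}(u_0), where N^{(k)} denotes the k-th derivative of N. -/
open Polynomial in
/-- Derivatives at `0` of `(f ∘ P) * h` for polynomials `P = a + Q` and `h` with `Q(0) = 0`. -/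
lemma iteratedDeriv_comp_polynomial_mul (Q : ℝ[X]) (hQ : X ∣ Q) (a : ℝ) (n : ℕ) :
    ∀ (f : ℝ → ℝ), ContDiff ℝ (⊤ : ℕ∞) f → ∀ h : ℝ[X],
      iteratedDeriv n (fun l => f (a + Q.eval l) * h.eval l) 0 =
        n.factorial * ∑ k ∈ Finset.range (n + 1),
          (Q ^ k * h).coeff n * (iteratedDeriv k f a / k.factorial) := by
  have hQ0 : Q.eval 0 = 0 := by
    obtain ⟨R, rfl⟩ := hQ
    simp
  induction n with
  | zero =>
    intro f _ h
    simp [hQ0, coeff_zero_eq_eval_zero, mul_comm]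
  | succ n ih =>
    intro f hf h
    have hf' : ContDiff ℝ (⊤ : ℕ∞) (deriv f) := (contDiff_infty_iff_deriv.mp hf).2
    have hpoly (p : ℝ[X]) : ContDiff ℝ (⊤ : ℕ∞) fun l => p.eval l := by
      simpa [aeval_def, eval₂_eq_eval_map] using p.contDiff_aeval (𝕜 := ℝ) (⊤ : ℕ∞)
    have hsmooth (g : ℝ → ℝ) (hg : ContDiff ℝ (⊤ : ℕ∞) g) (p : ℝ[X]) :
        ContDiff ℝ (⊤ : ℕ∞) (fun l => g (a + Q.eval l) * p.eval l) :=
      (hg.comp (contDiff_const.add (hpoly Q))).mul (hpoly p)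
    have hderiv : deriv (fun l => f (a + Q.eval l) * h.eval l) =
        (fun l => deriv f (a + Q.eval l) * (derivative Q * h).eval l) +
          fun l => f (a + Q.eval l) * (derivative h).eval l := by
      funext l
      have hfl : HasDerivAt f (deriv f (a + Q.eval l)) (a + Q.eval l) :=
        (hf.differentiable (by simp)).differentiableAt.hasDerivAt
      have hd := (hfl.comp l ((Q.hasDerivAt l).const_add a)).mul (h.hasDerivAt l)
      refine hd.deriv.trans ?_
      simp only [Pi.add_apply, Function.comp_apply, eval_mul]
      ring
    have hcoeff (k : ℕ) : (n + 1 : ℝ) * (Q ^ k * h).coeff (n + 1) =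
        k * (Q ^ (k - 1) * (derivative Q * h)).coeff n + (Q ^ k * derivative h).coeff n := by
      have hc := coeff_derivative (Q ^ k * h) n
      rw [derivative_mul, derivative_pow, coeff_add, mul_assoc, mul_assoc, coeff_C_mul] at hc
      rw [hc]
      ring
    have htop : (Q ^ (n + 1) * derivative h).coeff n = 0 :=
      X_pow_dvd_iff.mp ((pow_dvd_pow_of_dvd hQ _).mul_right _) n n.lt_succ_self
    have hle : ((n : ℕ∞) : WithTop ℕ∞) ≤ ((⊤ : ℕ∞) : WithTop ℕ∞) := by exact_mod_cast le_top
    rw [iteratedDeriv_succ', hderiv,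
      iteratedDeriv_add ((hsmooth _ hf' _).of_le hle).contDiffAt
        ((hsmooth _ hf _).of_le hle).contDiffAt,
      ih _ hf', ih _ hf, ← mul_add, Nat.factorial_succ, Nat.cast_mul, mul_comm ((n + 1 : ℕ) : ℝ),
      mul_assoc, Finset.mul_sum]
    congr 1
    have hsplit (k : ℕ) : ((n + 1 : ℕ) : ℝ) *
          ((Q ^ k * h).coeff (n + 1) * (iteratedDeriv k f a / k.factorial)) =
        k * (Q ^ (k - 1) * (derivative Q * h)).coeff n * (iteratedDeriv k f a / k.factorial) +
          (Q ^ k * derivative h).coeff n * (iteratedDeriv k f a / k.factorial) := by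
      rw [← mul_assoc, Nat.cast_succ, hcoeff, add_mul]
    simp_rw [hsplit]
    rw [Finset.sum_add_distrib, Finset.sum_range_succ' _ (n + 1),
      Finset.sum_range_succ (fun k => (Q ^ k * derivative h).coeff n * _) (n + 1), htop]
    simp only [Nat.cast_zero, zero_mul, add_zero, Nat.add_sub_cancel]
    congr 1
    refine Finset.sum_congr rfl fun k _ => ?_
    rw [iteratedDeriv_succ', Nat.factorial_succ]
    push_cast
    field_simp

/-- In the partition set `Λ^k_n`, the bound `n - k + 1` on the parts can be replaced by `n`. -/
lemma lambdaSet_eq_filter_Icc (n k : ℕ) (hk : 1 ≤ k) (hkn : k ≤ n) :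
    lambdaSet n k = (Finset.piAntidiag (Finset.Icc 1 n) k).filter
      (fun v => ∑ j ∈ Finset.Icc 1 n, j * v j = n) := by
  have hsub : Finset.Icc 1 (n - k + 1) ⊆ Finset.Icc 1 n :=
    Finset.Icc_subset_Icc_right (by omega)
  have hsum (v : ℕ → ℕ) (hv : ∀ i, v i ≠ 0 → i ∈ Finset.Icc 1 (n - k + 1)) (w : ℕ → ℕ) :
      ∑ j ∈ Finset.Icc 1 (n - k + 1), w j * v j = ∑ j ∈ Finset.Icc 1 n, w j * v j :=
    Finset.sum_subset hsub fun j _ hj => by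
      rw [not_not.mp (mt (hv j) hj), mul_zero]
  ext v
  simp only [lambdaSet, Finset.mem_filter, Finset.mem_piAntidiag]
  constructor
  · rintro ⟨⟨hs, hv⟩, hn⟩
    have h1 := hsum v hv (fun _ => 1)
    simp only [one_mul] at h1
    exact ⟨⟨h1 ▸ hs, fun i hi => hsub (hv i hi)⟩, hsum v hv id ▸ hn⟩
  · rintro ⟨⟨hs, hv⟩, hn⟩
    have hv' : ∀ i, v i ≠ 0 → i ∈ Finset.Icc 1 (n - k + 1) := by
      intro i hi
      have him := hv i hi
      have hadd : ∑ j ∈ Finset.Icc 1 n, (j - 1) * v j + k = n := by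
        conv_rhs => rw [← hn]
        rw [← hs, ← Finset.sum_add_distrib]
        refine Finset.sum_congr rfl fun j hj => ?_
        obtain ⟨m, rfl⟩ := Nat.exists_eq_add_of_le' (Finset.mem_Icc.mp hj).1
        rw [Nat.add_sub_cancel]
        ring
      have hle : (i - 1) * v i ≤ ∑ j ∈ Finset.Icc 1 n, (j - 1) * v j :=
        Finset.single_le_sum (f := fun j => (j - 1) * v j) (fun _ _ => Nat.zero_le _) him
      have hle' : i - 1 ≤ (i - 1) * v i := Nat.le_mul_of_pos_right _ (Nat.pos_of_ne_zero hi)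
      rw [Finset.mem_Icc] at him ⊢
      omega
    have h1 := hsum v hv' (fun _ => 1)
    simp only [one_mul] at h1
    exact ⟨⟨h1 ▸ hs, hv'⟩, (hsum v hv' id).trans hn⟩

open Polynomial in
/-- The partial ordinary Bell polynomials are the coefficients of powers of `∑ u_i X^i`. -/
lemma coeff_sum_pow_eq_bellBhat (n k : ℕ) (hk : 1 ≤ k) (hkn : k ≤ n) (u : ℕ → ℝ) :
    ((∑ i ∈ Finset.Icc 1 n, C (u i) * X ^ i) ^ k : ℝ[X]).coeff n = bellBhat n k u := by
  have hprod (v : ℕ → ℕ) : ∏ i ∈ Finset.Icc 1 n, (C (u i) * X ^ i : ℝ[X]) ^ v i =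
      C (∏ i ∈ Finset.Icc 1 n, u i ^ v i) * X ^ ∑ i ∈ Finset.Icc 1 n, i * v i := by
    simp_rw [mul_pow, Finset.prod_mul_distrib, ← pow_mul, Finset.prod_pow_eq_pow_sum, map_prod,
      map_pow]
  rw [bellBhat, Finset.sum_pow_eq_sum_piAntidiag, finsetSum_coeff, Finset.mul_sum]
  have hterm (v : ℕ → ℕ) :
      ((Nat.multinomial (Finset.Icc 1 n) v : ℝ[X]) *
        ∏ i ∈ Finset.Icc 1 n, (C (u i) * X ^ i : ℝ[X]) ^ v i).coeff n =
      if ∑ i ∈ Finset.Icc 1 n, i * v i = n then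
        Nat.multinomial (Finset.Icc 1 n) v * ∏ i ∈ Finset.Icc 1 n, u i ^ v i else 0 := by
    rw [hprod, coeff_natCast_mul, coeff_C_mul, coeff_X_pow]
    simp [eq_comm]
  simp_rw [hterm]
  rw [← Finset.sum_filter, ← lambdaSet_eq_filter_Icc n k hk hkn]
  refine Finset.sum_congr rfl fun v hv => ?_
  have hsupp := (Finset.mem_piAntidiag.mp (Finset.mem_filter.mp hv).1).2
  rw [lambdaSet_eq_filter_Icc n k hk hkn] at hv
  have hs := (Finset.mem_piAntidiag.mp (Finset.mem_filter.mp hv).1).1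
  have hext : ∏ j ∈ Finset.Icc 1 (n - k + 1), u j ^ v j / ((v j).factorial : ℝ) =
      ∏ j ∈ Finset.Icc 1 n, u j ^ v j / ((v j).factorial : ℝ) :=
    Finset.prod_subset (Finset.Icc_subset_Icc_right (by omega)) fun j _ hj => by
      simp [not_not.mp (mt (hsupp j) hj)]
  have hmul : (∏ i ∈ Finset.Icc 1 n, ((v i).factorial : ℝ)) *
      Nat.multinomial (Finset.Icc 1 n) v = k.factorial := by
    rw [← hs]
    exact_mod_cast Nat.multinomial_spec (Finset.Icc 1 n) v
  have hne : ∏ i ∈ Finset.Icc 1 n, ((v i).factorial : ℝ) ≠ 0 :=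
    Finset.prod_ne_zero_iff.mpr fun i _ => by positivity
  rw [hext, Finset.prod_div_distrib, ← hmul]
  field_simp

/-- For smooth `N : ℝ → ℝ` and `n ≥ 1`, the `n`-th Adomian polynomial of `N` is
`A_n(u_0, …, u_n) = Σ_{k=1}^{n} (1/k!) B̂_{n,k}(u_1, …, u_{n-k+1}) N^{(k)}(u_0)`. -/
theorem adomian_eq_sum_bellBhat (N : ℝ → ℝ) (hN : ContDiff ℝ (⊤ : ℕ∞) N) (n : ℕ) (hn : 1 ≤ n)
    (u : ℕ → ℝ) :
    adomian N n u =
      ∑ k ∈ Finset.Icc 1 n,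
        (1 / (Nat.factorial k : ℝ)) * bellBhat n k u * iteratedDeriv k N (u 0) := by
  set Q : Polynomial ℝ := ∑ i ∈ Finset.Icc 1 n, Polynomial.C (u i) * Polynomial.X ^ i with hQdef
  have hQ : Polynomial.X ∣ Q := Finset.dvd_sum fun i hi =>
    (dvd_pow_self _ (Nat.one_le_iff_ne_zero.mp (Finset.mem_Icc.mp hi).1)).mul_left _
  have hfun : (fun l : ℝ => N (∑ i ∈ Finset.range (n + 1), u i * l ^ i)) =
      fun l => N (u 0 + Q.eval l) * (1 : Polynomial ℝ).eval l := by
    funext l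
    rw [Polynomial.eval_one, mul_one, hQdef, Polynomial.eval_finsetSum,
      Finset.range_eq_Ico, Finset.sum_eq_sum_Ico_succ_bot (Nat.add_one_pos n)]
    simp [Finset.Ico_add_one_right_eq_Icc]
  have hpos : (0 : ℝ) < n.factorial := by positivity
  rw [adomian, hfun, iteratedDeriv_comp_polynomial_mul Q hQ (u 0) n N hN 1, ← mul_assoc,
    one_div_mul_cancel hpos.ne', one_mul, Finset.range_eq_Ico,
    Finset.sum_eq_sum_Ico_succ_bot (Nat.add_one_pos n)]
  have h0 : (Q ^ 0 * 1).coeff n = 0 := by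
    simp [Polynomial.coeff_one, Nat.one_le_iff_ne_zero.mp hn]
  rw [h0, zero_mul, zero_add, zero_add, Finset.Ico_add_one_right_eq_Icc]
  refine Finset.sum_congr rfl fun k hk => ?_
  obtain ⟨hk1, hkn⟩ := Finset.mem_Icc.mp hk
  rw [mul_one, coeff_sum_pow_eq_bellBhat n k hk1 hkn]
  ring
end

section
/- Let n and k be integers with 2 ≤ k ≤ n and let u_1, …, u_{n−k+1} be real numbers. Then B_{n,k}(1!·u_1, 2!·u_2, …, (n−k+1)!·u_{n−k+1}) = Σ_{j=0}^{n−k} (j+1)·(n−1)_j·u_{j+1}·B_{n−j−1,k−1}(1!·u_1, 2!·u_2, …, (n−j−k+1)!·u_{n−j−k+1}). -/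
/-- Functions supported on `s` with total mass `k` and weighted mass `∑ j * v j = n`. -/
def weightedAntidiag (s : Finset ℕ) (n k : ℕ) : Finset (ℕ → ℕ) :=
  (Finset.piAntidiag s k).filter (fun v => ∑ j ∈ s, j * v j = n)

theorem mem_weightedAntidiag {s : Finset ℕ} {n k : ℕ} {v : ℕ → ℕ} :
    v ∈ weightedAntidiag s n k ↔
      (∑ j ∈ s, v j = k ∧ ∀ j, v j ≠ 0 → j ∈ s) ∧ ∑ j ∈ s, j * v j = n := by
  simp [weightedAntidiag]

theorem weightedAntidiag_Icc_subset {n k N : ℕ} {v : ℕ → ℕ}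
    (hv : v ∈ weightedAntidiag (Finset.Icc 1 N) n k) {i : ℕ} (hi : v i ≠ 0) :
    i ∈ Finset.Icc 1 (n - k + 1) := by
  obtain ⟨⟨h1, h2⟩, h3⟩ := mem_weightedAntidiag.1 hv
  have hsum : ∑ j ∈ Finset.Icc 1 N, j * v j
      = ∑ j ∈ Finset.Icc 1 N, (j - 1) * v j + ∑ j ∈ Finset.Icc 1 N, v j := by
    rw [← Finset.sum_add_distrib]
    refine Finset.sum_congr rfl fun j hj => ?_
    obtain ⟨m, rfl⟩ := Nat.exists_eq_add_of_le' (Finset.mem_Icc.1 hj).1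
    simp only [Nat.add_sub_cancel]
    ring
  have hle : (i - 1) * v i ≤ ∑ j ∈ Finset.Icc 1 N, (j - 1) * v j :=
    Finset.single_le_sum (f := fun j => (j - 1) * v j) (fun _ _ => Nat.zero_le _) (h2 i hi)
  have hmul : i - 1 ≤ (i - 1) * v i := Nat.le_mul_of_pos_right _ (Nat.pos_of_ne_zero hi)
  have := Finset.mem_Icc.1 (h2 i hi)
  rw [Finset.mem_Icc]
  omega

theorem lambdaSet_eq_weightedAntidiag {n k N : ℕ} (hN : n - k + 1 ≤ N) :
    lambdaSet n k = weightedAntidiag (Finset.Icc 1 N) n k := by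
  have hsub : Finset.Icc 1 (n - k + 1) ⊆ Finset.Icc 1 N := Finset.Icc_subset_Icc_right hN
  change weightedAntidiag (Finset.Icc 1 (n - k + 1)) n k = _
  have key (v : ℕ → ℕ) (hv : ∀ j, v j ≠ 0 → j ∈ Finset.Icc 1 (n - k + 1)) :
      v ∈ weightedAntidiag (Finset.Icc 1 (n - k + 1)) n k ↔
        v ∈ weightedAntidiag (Finset.Icc 1 N) n k := by
    have hz (j : ℕ) (hj : j ∉ Finset.Icc 1 (n - k + 1)) : v j = 0 := by
      by_contra h
      exact hj (hv j h)
    rw [mem_weightedAntidiag, mem_weightedAntidiag,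
      Finset.sum_subset hsub (f := v) fun j _ hj => hz j hj,
      Finset.sum_subset hsub (f := fun j => j * v j) fun j _ hj => by simp [hz j hj]]
    have h (j : ℕ) (hj : v j ≠ 0) : j ∈ Finset.Icc 1 N := hsub (hv j hj)
    tauto
  ext v
  constructor
  · intro h
    exact (key v (mem_weightedAntidiag.1 h).1.2).1 h
  · intro h
    exact (key v fun j hj => weightedAntidiag_Icc_subset h hj).2 h

/-- The generating weight `∑ ∏ u_j ^ v_j / v_j!` over `weightedAntidiag s n k`. -/
noncomputable def weightSum (s : Finset ℕ) (u : ℕ → ℝ) (n k : ℕ) : ℝ :=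
  ∑ v ∈ weightedAntidiag s n k, ∏ j ∈ s, u j ^ v j / (Nat.factorial (v j) : ℝ)

theorem bellB_factorial_mul_s6 {n k N : ℕ} (hN : n - k + 1 ≤ N) (u : ℕ → ℝ) :
    bellB n k (fun j => (Nat.factorial j : ℝ) * u j) =
      (Nat.factorial n : ℝ) * weightSum (Finset.Icc 1 N) u n k := by
  rw [bellB, weightSum, lambdaSet_eq_weightedAntidiag hN]
  congr 1
  refine Finset.sum_congr rfl fun v hv => ?_
  have hfac (j : ℕ) : (Nat.factorial j : ℝ) ≠ 0 := Nat.cast_ne_zero.2 (Nat.factorial_ne_zero j)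
  calc _ = ∏ j ∈ Finset.Icc 1 (n - k + 1), u j ^ v j / (Nat.factorial (v j) : ℝ) := by
        refine Finset.prod_congr rfl fun j _ => ?_
        rw [mul_div_cancel_left₀ _ (hfac j), one_div, inv_mul_eq_div]
    _ = _ := by
        refine Finset.prod_subset (Finset.Icc_subset_Icc_right hN) fun j _ hj => ?_
        have : v j = 0 := by
          by_contra h
          exact hj (weightedAntidiag_Icc_subset hv h)
        simp [this]

theorem add_single_mem_weightedAntidiag {s : Finset ℕ} {n k m : ℕ} (hm : m ∈ s) {w : ℕ → ℕ} :
    w + Pi.single m 1 ∈ weightedAntidiag s (n + m) (k + 1) ↔ w ∈ weightedAntidiag s n k := by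
  have hsupp : (∀ j, (w + Pi.single m 1 : ℕ → ℕ) j ≠ 0 → j ∈ s) ↔ ∀ j, w j ≠ 0 → j ∈ s := by
    refine forall_congr' fun j => ?_
    by_cases hj : j = m
    · subst hj
      simp [hm]
    · simp [hj]
  rw [mem_weightedAntidiag, mem_weightedAntidiag, hsupp]
  simp [Pi.single_apply, mul_add, Finset.sum_add_distrib, hm]

theorem prod_add_single {s : Finset ℕ} {m : ℕ} (hm : m ∈ s) (u : ℕ → ℝ) (w : ℕ → ℕ) :
    ((w m : ℝ) + 1) * ∏ j ∈ s, u j ^ (w + Pi.single m 1 : ℕ → ℕ) j /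
        (Nat.factorial ((w + Pi.single m 1 : ℕ → ℕ) j) : ℝ) =
      u m * ∏ j ∈ s, u j ^ w j / (Nat.factorial (w j) : ℝ) := by
  rw [← Finset.mul_prod_erase s _ hm, ← Finset.mul_prod_erase s (fun j => u j ^ w j / _) hm]
  have hrest : ∏ j ∈ s.erase m, u j ^ (w + Pi.single m 1 : ℕ → ℕ) j /
        (Nat.factorial ((w + Pi.single m 1 : ℕ → ℕ) j) : ℝ) =
      ∏ j ∈ s.erase m, u j ^ w j / (Nat.factorial (w j) : ℝ) :=
    Finset.prod_congr rfl fun j hj => by simp [Finset.ne_of_mem_erase hj]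
  rw [hrest]
  have hfac : (Nat.factorial (w m) : ℝ) ≠ 0 := Nat.cast_ne_zero.2 (Nat.factorial_ne_zero _)
  have hpos : (w m : ℝ) + 1 ≠ 0 := by positivity
  simp only [Pi.add_apply, Pi.single_eq_same, Nat.factorial_succ, Nat.cast_mul, Nat.cast_add,
    Nat.cast_one, pow_succ]
  field_simp

theorem sum_apply_mul_prod {s : Finset ℕ} {m : ℕ} (hm : m ∈ s) (u : ℕ → ℝ) (n k : ℕ) :
    ∑ v ∈ weightedAntidiag s (n + m) (k + 1),
        (v m : ℝ) * ∏ j ∈ s, u j ^ v j / (Nat.factorial (v j) : ℝ) =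
      u m * weightSum s u n k := by
  rw [weightSum, Finset.mul_sum]
  symm
  refine Finset.sum_of_injOn (fun w => w + Pi.single m 1) (fun a _ b _ h => add_right_cancel h)
    (fun w hw => (add_single_mem_weightedAntidiag hm).2 hw) (fun v hv hnot => ?_) fun w _ => ?_
  · have : v m = 0 := by
      by_contra h
      have hv' : v - Pi.single m 1 + Pi.single m 1 = v := by
        ext j
        by_cases hj : j = m
        · subst hj
          simp
          omega
        · simp [hj]
      refine hnot ⟨v - Pi.single m 1, ?_, hv'⟩
      rw [← hv', add_single_mem_weightedAntidiag hm] at hv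
      exact hv
    simp [this]
  · simpa using (prod_add_single hm u w).symm

theorem mul_weightSum (s : Finset ℕ) (u : ℕ → ℝ) (n k : ℕ) (hs : ∀ m ∈ s, m ≤ n) :
    (n : ℝ) * weightSum s u n (k + 1) =
      ∑ m ∈ s, (m : ℝ) * u m * weightSum s u (n - m) k := by
  calc (n : ℝ) * weightSum s u n (k + 1)
      = ∑ v ∈ weightedAntidiag s n (k + 1), ∑ m ∈ s,
          (m : ℝ) * ((v m : ℝ) * ∏ j ∈ s, u j ^ v j / (Nat.factorial (v j) : ℝ)) := by
        rw [weightSum, Finset.mul_sum]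
        refine Finset.sum_congr rfl fun v hv => ?_
        simp only [← mul_assoc]
        rw [← Finset.sum_mul]
        congr 1
        exact_mod_cast (mem_weightedAntidiag.1 hv).2.symm
    _ = _ := by
        rw [Finset.sum_comm]
        refine Finset.sum_congr rfl fun m hm => ?_
        rw [← Finset.mul_sum, mul_assoc, ← sum_apply_mul_prod hm u (n - m) k,
          Nat.sub_add_cancel (hs m hm)]

/-- For `2 ≤ k ≤ n`,
`B_{n,k}(1!·u_1, …, (n-k+1)!·u_{n-k+1})
  = Σ_{j=0}^{n-k} (j+1)·(n-1)_j·u_{j+1}·B_{n-j-1,k-1}(1!·u_1, …, (n-j-k+1)!·u_{n-j-k+1})`,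
where `(n-1)_j` is the falling factorial. -/
theorem bellB_recurrence (n k : ℕ) (hk : 2 ≤ k) (hkn : k ≤ n) (u : ℕ → ℝ) :
    bellB n k (fun j => (Nat.factorial j : ℝ) * u j) =
      ∑ j ∈ Finset.range (n - k + 1),
        ((j : ℝ) + 1) * (Nat.descFactorial (n - 1) j : ℝ) * u (j + 1) *
          bellB (n - j - 1) (k - 1) (fun i => (Nat.factorial i : ℝ) * u i) := by
  obtain ⟨k, rfl⟩ := Nat.exists_eq_add_of_le' (show 1 ≤ k by omega)
  obtain ⟨n, rfl⟩ := Nat.exists_eq_add_of_le' (show 1 ≤ n by omega)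
  set N := n + 1 - (k + 1) + 1 with hN
  rw [bellB_factorial_mul_s6 le_rfl, Nat.factorial_succ, Nat.cast_mul, mul_comm (((n + 1 : ℕ) : ℝ)),
    mul_assoc, mul_weightSum _ _ _ _ fun m hm => by
      have := Finset.mem_Icc.1 hm
      omega,
    Finset.mul_sum, ← hN, Finset.range_eq_Ico, ← Finset.Ico_add_one_right_eq_Icc,
    ← Finset.sum_Ico_add' _ 0 N 1]
  refine Finset.sum_congr rfl fun j hj => ?_
  have hjN := (Finset.mem_Ico.1 hj).2
  rw [bellB_factorial_mul_s6 (N := N) (by omega), ← Finset.Ico_add_one_right_eq_Icc,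
    Nat.add_sub_cancel, Nat.add_sub_cancel, show n + 1 - j - 1 = n - j by omega,
    show n + 1 - (j + 1) = n - j by omega,
    ← Nat.factorial_mul_descFactorial (show j ≤ n by omega)]
  push_cast
  ring
end

section
/- Let n and k be integers with 2 ≤ k ≤ n−1. Regarding the partial exponential Bell polynomials as polynomials in the formal variables u_1, u_2, …, the following identity of polynomials holds: B_{n,k}(1!·u_1, 2!·u_2, …, (n−k+1)!·u_{n−k+1}) = u_1·B_{n−1,k−1}(1!·u_1, 2!·u_2, …, (n−k+1)!·u_{n−k+1}) + Σ_{j=1}^{n−k} (j+1)·u_{j+1}·∂/∂u_j [B_{n−1,k}(1!·u_1, 2!·u_2, …, (n−k)!·u_{n−k})], where ∂/∂u_j is the formal partial derivative with respect to u_j. -/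
/-- The partial exponential Bell polynomial, as a multivariate polynomial with rational
coefficients, evaluated at arguments `u`:
`B_{n,k}(u_1, …, u_{n-k+1}) = n! Σ_{Λ^k_n} Π_j (1/k_j!) (u_j/j!)^{k_j}`. -/
noncomputable def bellP (n k : ℕ) (u : ℕ → MvPolynomial ℕ ℚ) : MvPolynomial ℕ ℚ :=
  (Nat.factorial n : ℚ) • ∑ v ∈ lambdaSet n k, ∏ j ∈ Finset.Icc 1 (n - k + 1),
    ((Nat.factorial (v j) : ℚ) * (Nat.factorial j : ℚ) ^ (v j))⁻¹ • (u j) ^ (v j)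

/-- The partial ordinary Bell polynomial, as a multivariate polynomial with rational
coefficients, evaluated at arguments `u`:
`B̂_{n,k}(u_1, …, u_{n-k+1}) = k! Σ_{Λ^k_n} Π_j u_j^{k_j}/k_j!`. -/
noncomputable def bellPhat (n k : ℕ) (u : ℕ → MvPolynomial ℕ ℚ) : MvPolynomial ℕ ℚ :=
  (Nat.factorial k : ℚ) • ∑ v ∈ lambdaSet n k, ∏ j ∈ Finset.Icc 1 (n - k + 1),
    (Nat.factorial (v j) : ℚ)⁻¹ • (u j) ^ (v j)

/-- The product `∏ j, (m_j!)⁻¹` over the exponents of a multi-index `m`. -/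
def invFactorialProd (m : ℕ →₀ ℕ) : ℚ :=
  m.prod fun _ a => (Nat.factorial a : ℚ)⁻¹

/-- The multi-index `m` encodes a partition of `n` into `k` positive parts. -/
def IsPartitionIndex (n k : ℕ) (m : ℕ →₀ ℕ) : Prop :=
  m 0 = 0 ∧ m.degree = k ∧ Finsupp.weight (id : ℕ → ℕ) m = n

theorem invFactorialProd_eq_prod {m : ℕ →₀ ℕ} {s : Finset ℕ} (hs : m.support ⊆ s) :
    invFactorialProd m = ∏ j ∈ s, (Nat.factorial (m j) : ℚ)⁻¹ :=
  Finsupp.prod_of_support_subset m hs _ (by simp)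

theorem invFactorialProd_add_single (m : ℕ →₀ ℕ) (j : ℕ) :
    ((m j : ℚ) + 1) * invFactorialProd (m + Finsupp.single j 1) = invFactorialProd m := by
  have hj : j ∈ insert j m.support := Finset.mem_insert_self _ _
  have hs : (m + Finsupp.single j 1).support ⊆ insert j m.support := by
    intro i hi
    by_cases h : i = j <;> simp_all
  rw [invFactorialProd_eq_prod hs, invFactorialProd_eq_prod (Finset.subset_insert j m.support),
    ← Finset.mul_prod_erase _ _ hj, ← Finset.mul_prod_erase _ _ hj, ← mul_assoc]
  congr 1
  · have h1 : (m j : ℚ) + 1 ≠ 0 := by positivity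
    have h2 : (Nat.factorial (m j) : ℚ) ≠ 0 := by positivity
    simp only [Finsupp.add_apply, Finsupp.single_eq_same, Nat.factorial_succ]
    push_cast
    field_simp
  · refine Finset.prod_congr rfl fun i hi => ?_
    simp [Finsupp.single_eq_of_ne (Finset.ne_of_mem_erase hi)]

theorem degree_le_weight_id {m : ℕ →₀ ℕ} (h0 : m 0 = 0) :
    m.degree ≤ Finsupp.weight (id : ℕ → ℕ) m := by
  rw [Finsupp.degree_apply, Finsupp.weight_apply, Finsupp.sum]
  refine Finset.sum_le_sum fun i hi => ?_
  have hi0 : 0 < i := by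
    rcases Nat.eq_zero_or_pos i with rfl | h
    · simp_all
    · exact h
  simpa using Nat.le_mul_of_pos_right (m i) hi0

theorem IsPartitionIndex.support_subset {n k : ℕ} {m : ℕ →₀ ℕ} (h : IsPartitionIndex n k m) :
    m.support ⊆ Finset.Icc 1 (n - k + 1) := by
  obtain ⟨h0, hd, hw⟩ := h
  intro j hj
  have hj0 : j ≠ 0 := by
    rintro rfl
    simp_all
  obtain ⟨m, rfl⟩ : ∃ m', m = m' + Finsupp.single j 1 :=
    ⟨m - Finsupp.single j 1,
      (Finsupp.sub_add_single_one_cancel (Finsupp.mem_support_iff.mp hj)).symm⟩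
  have hm := degree_le_weight_id (m := m) (by simp_all)
  simp only [map_add, Finsupp.degree_single, Finsupp.weight_single, id, smul_eq_mul] at hd hw
  rw [Finset.mem_Icc]
  lia

theorem IsPartitionIndex.sum_mul_eq {n k : ℕ} {m : ℕ →₀ ℕ} (h : IsPartitionIndex n k m) :
    ∑ j ∈ Finset.Icc 1 (n - k + 1), j * m j = n := by
  have hw := h.2.2
  rw [Finsupp.weight_apply, Finsupp.sum_of_support_subset _ h.support_subset _ (by simp)] at hw
  simpa [mul_comm] using hw

theorem coe_mem_lambdaSet_iff {n k : ℕ} (m : ℕ →₀ ℕ) :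
    ⇑m ∈ lambdaSet n k ↔ IsPartitionIndex n k m := by
  rw [lambdaSet, Finset.mem_filter, Finset.mem_piAntidiag]
  constructor
  · rintro ⟨⟨hd, hs⟩, hw⟩
    have hs' : m.support ⊆ Finset.Icc 1 (n - k + 1) := fun i hi =>
      hs i (Finsupp.mem_support_iff.mp hi)
    refine ⟨?_, ?_, ?_⟩
    · by_contra h
      simpa using hs 0 h
    · rw [← hd, Finsupp.degree_apply]
      exact Finset.sum_subset hs' (by simp)
    · rw [Finsupp.weight_apply, Finsupp.sum_of_support_subset _ hs' _ (by simp)]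
      simpa [mul_comm] using hw
  · intro h
    refine ⟨⟨?_, fun i hi => h.support_subset (Finsupp.mem_support_iff.mpr hi)⟩, h.sum_mul_eq⟩
    refine (Finset.sum_subset h.support_subset fun i _ hi => ?_).symm.trans h.2.1
    exact Finsupp.notMem_support_iff.mp hi

theorem coeff_bellP_factorial (n k : ℕ) (m : ℕ →₀ ℕ) [Decidable (IsPartitionIndex n k m)] :
    MvPolynomial.coeff m (bellP n k fun j => (Nat.factorial j : ℚ) • MvPolynomial.X j) =
      if IsPartitionIndex n k m then (Nat.factorial n : ℚ) * invFactorialProd m else 0 := by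
  classical
  have hterm (v : ℕ → ℕ) (hv : v ∈ lambdaSet n k) :
      MvPolynomial.coeff m (∏ j ∈ Finset.Icc 1 (n - k + 1),
        ((Nat.factorial (v j) : ℚ) * (Nat.factorial j : ℚ) ^ (v j))⁻¹ •
          ((Nat.factorial j : ℚ) • (MvPolynomial.X j : MvPolynomial ℕ ℚ)) ^ (v j)) =
      if ⇑m = v then invFactorialProd m else 0 := by
    have hs : ∀ i, v i ≠ 0 → i ∈ Finset.Icc 1 (n - k + 1) :=
      (Finset.mem_piAntidiag.mp (Finset.mem_filter.mp hv).1).2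
    obtain ⟨w, rfl⟩ : ∃ w : ℕ →₀ ℕ, ⇑w = v := ⟨Finsupp.onFinset _ v hs, rfl⟩
    have hsub : w.support ⊆ Finset.Icc 1 (n - k + 1) := fun i hi =>
      hs i (Finsupp.mem_support_iff.mp hi)
    have hmon : (∏ j ∈ Finset.Icc 1 (n - k + 1),
        ((Nat.factorial (w j) : ℚ) * (Nat.factorial j : ℚ) ^ (w j))⁻¹ •
          ((Nat.factorial j : ℚ) • (MvPolynomial.X j : MvPolynomial ℕ ℚ)) ^ (w j)) =
        MvPolynomial.monomial w (invFactorialProd w) := by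
      rw [MvPolynomial.monomial_eq, invFactorialProd_eq_prod hsub,
        Finsupp.prod_of_support_subset _ hsub _ (by simp), map_prod, ← Finset.prod_mul_distrib]
      refine Finset.prod_congr rfl fun j _ => ?_
      have hj : (Nat.factorial j : ℚ) ≠ 0 := by positivity
      rw [smul_pow, smul_smul, MvPolynomial.C_mul', mul_inv, mul_assoc,
        inv_mul_cancel₀ (pow_ne_zero _ hj), mul_one]
    rw [hmon, MvPolynomial.coeff_monomial]
    by_cases h : w = m
    · simp [h]
    · rw [if_neg h, if_neg fun h' => h (DFunLike.coe_injective h').symm]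
  rw [bellP, MvPolynomial.coeff_smul, MvPolynomial.coeff_sum, Finset.sum_congr rfl hterm,
    Finset.sum_ite_eq]
  simp [coe_mem_lambdaSet_iff]

theorem isPartitionIndex_add_single_one_iff {n k : ℕ} (hn : 1 ≤ n) (hk : 1 ≤ k) (m : ℕ →₀ ℕ) :
    IsPartitionIndex n k (m + Finsupp.single 1 1) ↔ IsPartitionIndex (n - 1) (k - 1) m := by
  simp only [IsPartitionIndex, map_add, Finsupp.degree_single, Finsupp.weight_single, id,
    smul_eq_mul, Finsupp.add_apply, Finsupp.single_apply]
  lia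

theorem isPartitionIndex_add_single_succ_iff {n k j : ℕ} (hn : 1 ≤ n) (hj : 1 ≤ j)
    (m : ℕ →₀ ℕ) :
    IsPartitionIndex n k (m + Finsupp.single (j + 1) 1) ↔
      IsPartitionIndex (n - 1) k (m + Finsupp.single j 1) := by
  have hj0 : j ≠ 0 := by lia
  simp only [IsPartitionIndex, map_add, Finsupp.degree_single, Finsupp.weight_single, id,
    smul_eq_mul, Finsupp.add_apply, Finsupp.single_apply, hj0, Nat.succ_ne_zero, if_false]
  lia

theorem coeff_X_one_mul_bellP {n k : ℕ} (hn : 1 ≤ n) (hk : 1 ≤ k) (m : ℕ →₀ ℕ)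
    [Decidable (IsPartitionIndex n k m)] :
    MvPolynomial.coeff m (MvPolynomial.X 1 *
        bellP (n - 1) (k - 1) fun j => (Nat.factorial j : ℚ) • MvPolynomial.X j) =
      if IsPartitionIndex n k m then
        (m 1 : ℚ) * (Nat.factorial (n - 1) * invFactorialProd m) else 0 := by
  classical
  rw [MvPolynomial.coeff_X_mul']
  by_cases hm : m 1 = 0
  · simp [hm]
  obtain ⟨m, rfl⟩ : ∃ m', m = m' + Finsupp.single 1 1 :=
    ⟨_, (Finsupp.sub_add_single_one_cancel hm).symm⟩
  rw [if_pos (Finsupp.mem_support_iff.mpr hm), add_tsub_cancel_right, coeff_bellP_factorial]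
  simp only [isPartitionIndex_add_single_one_iff hn hk]
  refine if_congr Iff.rfl ?_ rfl
  rw [← invFactorialProd_add_single m 1]
  simp only [Finsupp.add_apply, Finsupp.single_eq_same]
  push_cast
  ring

theorem coeff_X_succ_mul_pderiv_bellP {n k j : ℕ} (hn : 1 ≤ n) (hj : 1 ≤ j) (m : ℕ →₀ ℕ)
    [Decidable (IsPartitionIndex n k m)] :
    MvPolynomial.coeff m (MvPolynomial.X (j + 1) * MvPolynomial.pderiv j
        (bellP (n - 1) k fun i => (Nat.factorial i : ℚ) • MvPolynomial.X i)) =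
      if IsPartitionIndex n k m then
        (m (j + 1) : ℚ) * (Nat.factorial (n - 1) * invFactorialProd m) else 0 := by
  classical
  rw [MvPolynomial.coeff_X_mul']
  by_cases hm : m (j + 1) = 0
  · simp [hm]
  obtain ⟨m, rfl⟩ : ∃ m', m = m' + Finsupp.single (j + 1) 1 :=
    ⟨_, (Finsupp.sub_add_single_one_cancel hm).symm⟩
  rw [if_pos (Finsupp.mem_support_iff.mpr hm), add_tsub_cancel_right, MvPolynomial.coeff_pderiv,
    coeff_bellP_factorial, ite_mul, zero_mul]
  simp only [isPartitionIndex_add_single_succ_iff hn hj]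
  refine if_congr Iff.rfl ?_ rfl
  have h := (invFactorialProd_add_single m j).trans (invFactorialProd_add_single m (j + 1)).symm
  simp only [Finsupp.add_apply, Finsupp.single_eq_same]
  push_cast
  linear_combination (Nat.factorial (n - 1) : ℚ) * h

/-- For `2 ≤ k ≤ n - 1`, as an identity of polynomials in the formal variables
`u_j = X j`:
`B_{n,k}(1!·u_1, …, (n-k+1)!·u_{n-k+1})
  = u_1·B_{n-1,k-1}(1!·u_1, …, (n-k+1)!·u_{n-k+1})
    + Σ_{j=1}^{n-k} (j+1)·u_{j+1}·∂/∂u_j [B_{n-1,k}(1!·u_1, …, (n-k)!·u_{n-k})]`. -/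
theorem bellP_pderiv_recurrence (n k : ℕ) (hk : 2 ≤ k) (hkn : k ≤ n - 1) :
    bellP n k (fun j => (Nat.factorial j : ℚ) • MvPolynomial.X j) =
      MvPolynomial.X 1 *
        bellP (n - 1) (k - 1) (fun j => (Nat.factorial j : ℚ) • MvPolynomial.X j) +
      ∑ j ∈ Finset.Icc 1 (n - k), ((j : ℚ) + 1) •
        (MvPolynomial.X (j + 1) *
          MvPolynomial.pderiv j
            (bellP (n - 1) k (fun i => (Nat.factorial i : ℚ) • MvPolynomial.X i))) := by
  classical
  have hn : 1 ≤ n := by lia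
  ext m
  simp only [MvPolynomial.coeff_add, MvPolynomial.coeff_sum, MvPolynomial.coeff_smul]
  rw [coeff_bellP_factorial, coeff_X_one_mul_bellP hn (by lia),
    Finset.sum_congr rfl fun j hj => by
      rw [coeff_X_succ_mul_pderiv_bellP hn (Finset.mem_Icc.mp hj).1]]
  by_cases h : IsPartitionIndex n k m
  · have hsum : ((m 1 : ℚ) + ∑ j ∈ Finset.Icc 1 (n - k), ((j : ℚ) + 1) * m (j + 1)) = n := by
      have hs := h.sum_mul_eq
      rw [← Finset.add_sum_Ioc_eq_sum_Icc (by lia), ← Finset.Icc_add_one_left_eq_Ioc,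
        ← Finset.map_add_right_Icc, Finset.sum_map] at hs
      simp only [addRightEmbedding_apply, one_mul] at hs
      exact_mod_cast hs
    simp only [if_pos h, smul_eq_mul, ← mul_assoc, ← Finset.sum_mul, ← add_mul]
    rw [hsum, ← Nat.mul_factorial_pred (by lia : n ≠ 0)]
    push_cast
    ring
  · simp [h]
end

section
/- Let n and k be integers with 2 ≤ k ≤ n−1. Regarding the partial ordinary Bell polynomials as polynomials in the formal variables u_1, u_2, …, the following identity of polynomials holds: B̂_{n,k}(u_1, u_2, …, u_{n−k+1}) = (k/n)·u_1·B̂_{n−1,k−1}(u_1, u_2, …, u_{n−k+1}) + (1/n) Σ_{j=1}^{n−k} (j+1)·u_{j+1}·∂/∂u_j [B̂_{n−1,k}(u_1, u_2, …, u_{n−k})], where ∂/∂u_j is the formal partial derivative with respect to u_j. -/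
open Finset in
/-- The `k`-th power of `∑ u_j t^j`, `1 ≤ j ≤ n - k + 1`, has coefficient `B̂_{n,k}(u)` at `t^n`. -/
theorem bellPhat_eq_coeff (n k : ℕ) (u : ℕ → MvPolynomial ℕ ℚ) :
    bellPhat n k u =
      ((∑ j ∈ Icc 1 (n - k + 1), Polynomial.monomial j (u j)) ^ k).coeff n := by
  rw [sum_pow_eq_sum_piAntidiag, Polynomial.finsetSum_coeff, bellPhat, lambdaSet, sum_filter,
    smul_sum]
  refine sum_congr rfl fun v hv => ?_
  have hv_sum : ∑ j ∈ Icc 1 (n - k + 1), v j = k := (mem_piAntidiag.mp hv).1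
  have hprod : ∏ j ∈ Icc 1 (n - k + 1), Polynomial.monomial j (u j) ^ v j =
      Polynomial.monomial (∑ j ∈ Icc 1 (n - k + 1), j * v j)
        (∏ j ∈ Icc 1 (n - k + 1), u j ^ v j) := by
    simp only [← Polynomial.C_mul_X_pow_eq_monomial, mul_pow, prod_mul_distrib, map_prod, map_pow,
      ← pow_mul, prod_pow_eq_pow_sum]
  have hmult : (k.factorial : ℚ) * ∏ j ∈ Icc 1 (n - k + 1), ((v j).factorial : ℚ)⁻¹ =
      Nat.multinomial (Icc 1 (n - k + 1)) v := by
    have h := Nat.multinomial_spec (Icc 1 (n - k + 1)) v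
    rw [hv_sum] at h
    have h0 : (∏ j ∈ Icc 1 (n - k + 1), ((v j).factorial : ℚ)) ≠ 0 :=
      prod_ne_zero_iff.mpr fun j _ => Nat.cast_ne_zero.mpr (Nat.factorial_ne_zero _)
    rw [← h, prod_inv_distrib]
    push_cast
    field_simp
  rw [hprod, Polynomial.coeff_natCast_mul, Polynomial.coeff_monomial]
  split_ifs with h
  · rw [prod_smul, smul_smul, hmult, ← nsmul_eq_mul, Nat.cast_smul_eq_nsmul]
  · simp

/-- Terms of degree above `N` do not contribute to the coefficients of degree less than `N + k` of
the `k`-th power of a polynomial without constant term. -/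
theorem coeff_sum_monomial_pow_succ {R : Type*} [CommRing R] (u : ℕ → R) {N k m : ℕ}
    (hm : m < N + k) :
    ((∑ j ∈ Finset.Icc 1 (N + 1), Polynomial.monomial j (u j)) ^ k).coeff m =
      ((∑ j ∈ Finset.Icc 1 N, Polynomial.monomial j (u j)) ^ k).coeff m := by
  have hfac : ∀ M : ℕ, ∑ j ∈ Finset.Icc 1 M, Polynomial.monomial j (u j) =
      Polynomial.X * ∑ i ∈ Finset.range M, Polynomial.monomial i (u (i + 1)) := by
    intro M
    induction M with
    | zero => simp
    | succ M ih =>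
      rw [Finset.sum_Icc_succ_top (by omega), ih, Finset.sum_range_succ, mul_add,
        Polynomial.X_mul_monomial]
  have hdvd : (Polynomial.X : Polynomial R) ^ N ∣
      (∑ i ∈ Finset.range (N + 1), Polynomial.monomial i (u (i + 1))) ^ k -
        (∑ i ∈ Finset.range N, Polynomial.monomial i (u (i + 1))) ^ k := by
    refine dvd_trans ?_ (sub_dvd_pow_sub_pow _ _ k)
    rw [Finset.sum_range_succ, add_sub_cancel_left, ← Polynomial.C_mul_X_pow_eq_monomial]
    exact dvd_mul_left _ _
  rw [← sub_eq_zero, ← Polynomial.coeff_sub, hfac, hfac, mul_pow, mul_pow, ← mul_sub]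
  refine Polynomial.X_pow_dvd_iff.mp (?_ : Polynomial.X ^ (N + k) ∣ _) m hm
  rw [add_comm, pow_add]
  exact mul_dvd_mul_left _ hdvd

/-- The chain rule for the partial derivative, in a coefficient, of a power of the generating
polynomial of the variables. -/
theorem pderiv_coeff_sum_monomial_X_pow {N j : ℕ} (hj : j ∈ Finset.Icc 1 N) (k m : ℕ) :
    MvPolynomial.pderiv j (((∑ i ∈ Finset.Icc 1 N,
      Polynomial.monomial i (MvPolynomial.X i : MvPolynomial ℕ ℚ)) ^ k).coeff m) =
      ((k : Polynomial (MvPolynomial ℕ ℚ)) * (∑ i ∈ Finset.Icc 1 N,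
        Polynomial.monomial i (MvPolynomial.X i)) ^ (k - 1) * Polynomial.X ^ j).coeff m := by
  let _ : Differential (MvPolynomial ℕ ℚ) :=
    ⟨(MvPolynomial.pderiv j).restrictScalars ℤ⟩
  have hderiv : ∀ p : MvPolynomial ℕ ℚ, Differential.deriv p = MvPolynomial.pderiv j p :=
    fun _ => rfl
  have hgen : Differential.mapCoeffs (∑ i ∈ Finset.Icc 1 N,
      Polynomial.monomial i (MvPolynomial.X i : MvPolynomial ℕ ℚ)) = Polynomial.X ^ j := by
    rw [map_sum, Finset.sum_eq_single_of_mem j hj fun i _ hij => ?_]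
    · rw [Differential.mapCoeffs_monomial, hderiv, MvPolynomial.pderiv_X_self,
        Polynomial.monomial_one_right_eq_X_pow]
    · rw [Differential.mapCoeffs_monomial, hderiv, MvPolynomial.pderiv_X_of_ne hij,
        Polynomial.monomial_zero_right]
  rw [← hderiv, ← Differential.coeff_mapCoeffs, Derivation.leibniz_pow, hgen, nsmul_eq_mul,
    smul_eq_mul, mul_assoc]

/-- Differentiating `∑ u_j t^j` with respect to `t`. -/
theorem derivative_sum_monomial_succ {R : Type*} [CommRing R] (u : ℕ → R) (N : ℕ) :
    Polynomial.derivative (∑ j ∈ Finset.Icc 1 (N + 1), Polynomial.monomial j (u j)) =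
      Polynomial.C (u 1) + ∑ j ∈ Finset.Icc 1 N,
        Polynomial.C (((j : R) + 1) * u (j + 1)) * Polynomial.X ^ j := by
  induction N with
  | zero => simp
  | succ N ih =>
    rw [Finset.sum_Icc_succ_top (by omega), map_add, ih, Finset.sum_Icc_succ_top (by omega),
      Polynomial.derivative_monomial, Polynomial.C_mul_X_pow_eq_monomial, add_assoc]
    simp [mul_comm]

/-- For `2 ≤ k ≤ n - 1`, as an identity of polynomials in the formal variables `u_j = X j`:
`B̂_{n,k}(u_1, …, u_{n-k+1})
  = (k/n)·u_1·B̂_{n-1,k-1}(u_1, …, u_{n-k+1})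
    + (1/n) Σ_{j=1}^{n-k} (j+1)·u_{j+1}·∂/∂u_j [B̂_{n-1,k}(u_1, …, u_{n-k})]`. -/
theorem bellPhat_pderiv_recurrence (n k : ℕ) (hk : 2 ≤ k) (hkn : k ≤ n - 1) :
    bellPhat n k (fun j => MvPolynomial.X j) =
      ((k : ℚ) / (n : ℚ)) •
        (MvPolynomial.X 1 * bellPhat (n - 1) (k - 1) (fun j => MvPolynomial.X j)) +
      ((n : ℚ))⁻¹ • ∑ j ∈ Finset.Icc 1 (n - k), ((j : ℚ) + 1) •
        (MvPolynomial.X (j + 1) *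
          MvPolynomial.pderiv j (bellPhat (n - 1) k (fun i => MvPolynomial.X i))) := by
  obtain ⟨m, rfl⟩ : ∃ m, n = m + 1 := ⟨n - 1, by omega⟩
  rw [Nat.add_sub_cancel] at *
  have hn : ((m + 1 : ℕ) : ℚ) ≠ 0 := Nat.cast_ne_zero.mpr (Nat.succ_ne_zero m)
  set N := m + 1 - k with hN
  set F : Polynomial (MvPolynomial ℕ ℚ) :=
    ∑ j ∈ Finset.Icc 1 (N + 1), Polynomial.monomial j (MvPolynomial.X j) with hF
  have h₁ : bellPhat (m + 1) k (fun j => MvPolynomial.X j) = (F ^ k).coeff (m + 1) :=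
    bellPhat_eq_coeff _ _ _
  have h₂ : bellPhat m (k - 1) (fun j => MvPolynomial.X j) = (F ^ (k - 1)).coeff m := by
    rw [bellPhat_eq_coeff, hF, show m - (k - 1) + 1 = N + 1 by omega]
  have h₃ : bellPhat m k (fun j => MvPolynomial.X j) = (F ^ k).coeff m := by
    rw [bellPhat_eq_coeff, hF, show m - k + 1 = N by omega,
      coeff_sum_monomial_pow_succ _ (by omega)]
  have hderiv : (m + 1 : ℚ) • (F ^ k).coeff (m + 1) =
      (k : ℚ) • (MvPolynomial.X 1 * (F ^ (k - 1)).coeff m) +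
      ∑ j ∈ Finset.Icc 1 N, ((j : ℚ) + 1) •
        (MvPolynomial.X (j + 1) * MvPolynomial.pderiv j ((F ^ k).coeff m)) := by
    have h := Polynomial.coeff_derivative (F ^ k) m
    rw [Polynomial.derivative_pow, hF, derivative_sum_monomial_succ, ← hF, mul_add, Finset.mul_sum,
      Polynomial.coeff_add, Polynomial.finsetSum_coeff] at h
    have hsum : ∀ j ∈ Finset.Icc 1 N, ((j : ℚ) + 1) •
        (MvPolynomial.X (j + 1) * MvPolynomial.pderiv j ((F ^ k).coeff m)) =
        (Polynomial.C (k : MvPolynomial ℕ ℚ) * F ^ (k - 1) *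
          (Polynomial.C (((j : MvPolynomial ℕ ℚ) + 1) * MvPolynomial.X (j + 1)) *
            Polynomial.X ^ j)).coeff m := by
      intro j hj
      rw [hF, pderiv_coeff_sum_monomial_X_pow (Finset.Icc_subset_Icc_right N.le_succ hj), ← hF,
        mul_left_comm, Polynomial.coeff_C_mul, Polynomial.C_eq_natCast, MvPolynomial.smul_eq_C_mul]
      simp [mul_assoc]
    rw [Finset.sum_congr rfl hsum, MvPolynomial.smul_eq_C_mul, MvPolynomial.smul_eq_C_mul]
    rw [Polynomial.coeff_mul_C, Polynomial.coeff_C_mul] at h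
    simp only [map_natCast] at h
    simp only [map_add, map_natCast, map_one]
    linear_combination -h
  rw [h₁, h₂, h₃, div_eq_inv_mul, mul_smul, ← smul_add, ← hderiv, smul_smul]
  push_cast at hn ⊢
  rw [inv_mul_cancel₀ hn, one_smul]
end

section
/- Let α and β be real numbers and let n ≥ 1 be an integer. Then Σ_{k=1}^{n} (−β)^k · B_{n,k}(v_1, v_2, …, v_{n−k+1}) = n!·(−αβ)^n, where the j-th argument is v_j = (−1)^{j−1}·(j−1)!·α^j·β^{j−1} for j = 1, …, n−k+1 (i.e. the arguments are 0!·α, −1!·α²β, 2!·α³β², …, (−1)^{n−k}(n−k)!·α^{n−k+1}β^{n−k}). -/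
open Finset Classical in
/-- Multiplicity functions, supported on `{1, …, N}`, of the partitions of `m` with parts
at most `N`. -/
noncomputable def partMultiplicities (N m : ℕ) : Finset (ℕ → ℕ) :=
  ((range (m + 1)).biUnion (piAntidiag (Icc 1 N))).filter
    (fun v => ∑ j ∈ Icc 1 N, j * v j = m)

/-- The inverse `∏ j, 1 / (j ^ v_j * v_j!)` of the order of the centralizer of a permutation
with `v j` cycles of length `j`. -/
noncomputable def cycleWeight (N : ℕ) (v : ℕ → ℕ) : ℝ :=
  ∏ j ∈ Finset.Icc 1 N, ((j : ℝ) ^ v j * (Nat.factorial (v j) : ℝ))⁻¹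

open Finset in
theorem mem_partMultiplicities {N m : ℕ} {v : ℕ → ℕ} :
    v ∈ partMultiplicities N m ↔
      (∀ j, v j ≠ 0 → j ∈ Icc 1 N) ∧ ∑ j ∈ Icc 1 N, j * v j = m := by
  simp only [partMultiplicities, mem_filter, mem_biUnion, mem_piAntidiag, mem_range]
  constructor
  · rintro ⟨⟨k, -, -, hs⟩, hm⟩
    exact ⟨hs, hm⟩
  · rintro ⟨hs, hm⟩
    refine ⟨⟨∑ j ∈ Icc 1 N, v j, ?_, rfl, hs⟩, hm⟩
    rw [Nat.lt_succ_iff, ← hm]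
    exact sum_le_sum fun j hj => Nat.le_mul_of_pos_left _ (mem_Icc.1 hj).1

open Finset in
theorem mul_cycleWeight_add_single {N j : ℕ} (hj : j ∈ Icc 1 N) (u : ℕ → ℕ) :
    ((j * (u j + 1) : ℕ) : ℝ) * cycleWeight N (u + Pi.single j 1) = cycleWeight N u := by
  have hj0 : (j : ℝ) ≠ 0 := by
    have := (mem_Icc.1 hj).1
    positivity
  have hrest : ∏ i ∈ (Icc 1 N).erase j,
      ((i : ℝ) ^ (u + Pi.single j 1 : ℕ → ℕ) i * (Nat.factorial ((u + Pi.single j 1 : ℕ → ℕ) i) : ℝ))⁻¹ =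
      ∏ i ∈ (Icc 1 N).erase j, ((i : ℝ) ^ u i * (Nat.factorial (u i) : ℝ))⁻¹ :=
    prod_congr rfl fun i hi => by simp [Pi.single_eq_of_ne (ne_of_mem_erase hi)]
  rw [cycleWeight, cycleWeight, ← mul_prod_erase _ _ hj, ← mul_prod_erase _ _ hj, hrest,
    ← mul_assoc]
  congr 1
  have hu : ((u j : ℝ) + 1) ≠ 0 := by positivity
  have hf : (Nat.factorial (u j) : ℝ) ≠ 0 := by positivity
  simp only [Pi.add_apply, Pi.single_eq_same, Nat.factorial_succ, pow_succ]
  push_cast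
  field_simp

open Finset in
theorem sum_mul_add_single {N j : ℕ} (hj : j ∈ Icc 1 N) (u : ℕ → ℕ) :
    ∑ i ∈ Icc 1 N, i * (u + Pi.single j 1 : ℕ → ℕ) i = ∑ i ∈ Icc 1 N, i * u i + j := by
  simp [mul_add, sum_add_distrib, Pi.single_apply, mem_Icc.1 hj]

open Finset in
theorem sum_mul_cycleWeight {N m j : ℕ} (hj : j ∈ Icc 1 N) (hjm : j ≤ m) :
    ∑ v ∈ partMultiplicities N m, ((j * v j : ℕ) : ℝ) * cycleWeight N v =
      ∑ u ∈ partMultiplicities N (m - j), cycleWeight N u := by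
  have hsub : ∀ v : ℕ → ℕ, v j ≠ 0 → v - Pi.single j 1 + Pi.single j 1 = v := by
    intro v hv
    refine tsub_add_cancel_of_le fun i => ?_
    obtain rfl | h := eq_or_ne i j
    · simpa using Nat.one_le_iff_ne_zero.2 hv
    · simp [h]
  rw [← sum_filter_of_ne (p := fun v => v j ≠ 0) (by
    rintro v - hv h0
    simp [h0] at hv)]
  symm
  refine sum_nbij' (· + Pi.single j 1) (· - Pi.single j 1) ?_ ?_ ?_ ?_ ?_
  · intro u hu
    rw [mem_partMultiplicities] at hu
    rw [mem_filter, mem_partMultiplicities, sum_mul_add_single hj, hu.2]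
    refine ⟨⟨fun i hi => ?_, by omega⟩, by simp⟩
    obtain rfl | h := eq_or_ne i j
    · exact hj
    · exact hu.1 i (by simpa [h] using hi)
  · intro v hv
    rw [mem_filter, mem_partMultiplicities] at hv
    rw [mem_partMultiplicities]
    refine ⟨fun i hi => hv.1.1 i fun h => hi (by simp [h]), ?_⟩
    have := sum_mul_add_single hj (v - Pi.single j 1)
    rw [hsub v hv.2, hv.1.2] at this
    omega
  · intro u _
    simp
  · intro v hv
    exact hsub v (mem_filter.1 hv).2
  · intro u _
    simpa using (mul_cycleWeight_add_single hj u).symm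

open Finset in
theorem sum_cycleWeight_eq_one {N m : ℕ} (hm : m ≤ N) :
    ∑ v ∈ partMultiplicities N m, cycleWeight N v = 1 := by
  induction m using Nat.strong_induction_on with
  | _ m ih =>
  obtain rfl | hm0 := Nat.eq_zero_or_pos m
  · have : partMultiplicities N 0 = {0} := by
      ext v
      rw [mem_partMultiplicities, mem_singleton]
      constructor
      · rintro ⟨hs, h0⟩
        funext j
        by_contra hj
        have hjN := hs j hj
        have := sum_eq_zero_iff.1 h0 j hjN
        rw [mul_eq_zero] at this
        have := (mem_Icc.1 hjN).1
        simp at hj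
        omega
      · rintro rfl
        simp
    simp [this, cycleWeight]
  · have hmR : (m : ℝ) ≠ 0 := by positivity
    refine mul_left_cancel₀ hmR ?_
    calc (m : ℝ) * ∑ v ∈ partMultiplicities N m, cycleWeight N v
        = ∑ v ∈ partMultiplicities N m, ∑ j ∈ Icc 1 N,
            ((j * v j : ℕ) : ℝ) * cycleWeight N v := by
          rw [mul_sum]
          refine sum_congr rfl fun v hv => ?_
          rw [← sum_mul, ← Nat.cast_sum, (mem_partMultiplicities.1 hv).2]
      _ = ∑ j ∈ Icc 1 N, ∑ v ∈ partMultiplicities N m,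
            ((j * v j : ℕ) : ℝ) * cycleWeight N v := sum_comm
      _ = ∑ j ∈ Icc 1 m, ∑ v ∈ partMultiplicities N m,
            ((j * v j : ℕ) : ℝ) * cycleWeight N v := by
          symm
          refine sum_subset (Icc_subset_Icc_right hm) fun j hj hjm => ?_
          refine sum_eq_zero fun v hv => ?_
          have hle : j * v j ≤ m := by
            conv_rhs => rw [← (mem_partMultiplicities.1 hv).2]
            exact single_le_sum (f := fun j => j * v j) (fun _ _ => Nat.zero_le _) hj
          have hlt : m < j := by
            rw [mem_Icc] at hj hjm
            omega
          have : v j = 0 := by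
            by_contra h
            have := Nat.le_mul_of_pos_right j (Nat.pos_of_ne_zero h)
            omega
          simp [this]
      _ = ∑ j ∈ Icc 1 m, 1 := by
          refine sum_congr rfl fun j hj => ?_
          rw [mem_Icc] at hj
          rw [sum_mul_cycleWeight (mem_Icc.2 ⟨hj.1, hj.2.trans hm⟩) hj.2,
            ih (m - j) (by omega) (by omega)]
      _ = m * 1 := by simp

open Finset in
/-- A part of a partition of `n` into `k` parts is at most `n - k + 1`. -/
theorem le_sub_add_one_of_mem {n k j : ℕ} {v : ℕ → ℕ} (hv : v ∈ partMultiplicities n n)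
    (hk : ∑ i ∈ Icc 1 n, v i = k) (hj : v j ≠ 0) : j ≤ n - k + 1 := by
  rw [mem_partMultiplicities] at hv
  have hjn := hv.1 j hj
  have hsum := hv.2
  rw [← add_sum_erase _ _ hjn] at hsum hk
  have hle : ∑ i ∈ (Icc 1 n).erase j, v i ≤ ∑ i ∈ (Icc 1 n).erase j, i * v i :=
    sum_le_sum fun i hi => Nat.le_mul_of_pos_left _ (mem_Icc.1 (mem_of_mem_erase hi)).1
  obtain ⟨a, ha⟩ := Nat.exists_eq_succ_of_ne_zero hj
  obtain ⟨b, rfl⟩ := Nat.exists_eq_add_of_le (mem_Icc.1 hjn).1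
  rw [ha] at hsum hk
  have : (1 + b) * a.succ = a + 1 + b + b * a := by
    rw [Nat.succ_eq_add_one]
    ring
  omega

open Finset in
theorem lambdaSet_eq_filter {n k : ℕ} (hk : k ∈ Icc 1 n) :
    lambdaSet n k = (partMultiplicities n n).filter (fun v => ∑ i ∈ Icc 1 n, v i = k) := by
  rw [mem_Icc] at hk
  have hsub : Icc 1 (n - k + 1) ⊆ Icc 1 n := Icc_subset_Icc_right (by omega)
  have hext : ∀ v : ℕ → ℕ, (∀ j, v j ≠ 0 → j ∈ Icc 1 (n - k + 1)) →
      ∑ j ∈ Icc 1 (n - k + 1), v j = ∑ j ∈ Icc 1 n, v j ∧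
      ∑ j ∈ Icc 1 (n - k + 1), j * v j = ∑ j ∈ Icc 1 n, j * v j := by
    intro v hv
    have h0 : ∀ j, j ∉ Icc 1 (n - k + 1) → v j = 0 := fun j hj => not_not.1 (mt (hv j) hj)
    exact ⟨sum_subset hsub fun j _ hj => h0 j hj,
      sum_subset hsub fun j _ hj => by rw [h0 j hj, mul_zero]⟩
  ext v
  rw [lambdaSet, mem_filter, mem_filter, mem_piAntidiag]
  constructor
  · rintro ⟨⟨h1, hs⟩, h2⟩
    obtain ⟨e1, e2⟩ := hext v hs
    exact ⟨mem_partMultiplicities.2 ⟨fun j hj => hsub (hs j hj), e2 ▸ h2⟩, e1 ▸ h1⟩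
  · rintro ⟨hv, h1⟩
    have hs : ∀ j, v j ≠ 0 → j ∈ Icc 1 (n - k + 1) := fun j hj =>
      mem_Icc.2 ⟨(mem_Icc.1 ((mem_partMultiplicities.1 hv).1 j hj)).1,
        le_sub_add_one_of_mem hv h1 hj⟩
    obtain ⟨e1, e2⟩ := hext v hs
    exact ⟨⟨e1.trans h1, hs⟩, e2.trans (mem_partMultiplicities.1 hv).2⟩

open Finset in
theorem neg_pow_mul_prod_eq_cycleWeight (α β : ℝ) {n k : ℕ} (hk : k ∈ Icc 1 n) {v : ℕ → ℕ}
    (hv : v ∈ lambdaSet n k) :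
    (-β) ^ k * ∏ j ∈ Icc 1 (n - k + 1), (1 / (Nat.factorial (v j) : ℝ)) *
      ((-1 : ℝ) ^ (j - 1) * (Nat.factorial (j - 1) : ℝ) * α ^ j * β ^ (j - 1) /
        (Nat.factorial j : ℝ)) ^ v j =
    (-(α * β)) ^ n * cycleWeight n v := by
  have hsub : Icc 1 (n - k + 1) ⊆ Icc 1 n := by
    rw [mem_Icc] at hk
    exact Icc_subset_Icc_right (by omega)
  rw [lambdaSet, mem_filter, mem_piAntidiag] at hv
  obtain ⟨⟨h1, hs⟩, h2⟩ := hv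
  have hw : cycleWeight n v =
      ∏ j ∈ Icc 1 (n - k + 1), ((j : ℝ) ^ v j * (Nat.factorial (v j) : ℝ))⁻¹ := by
    symm
    refine prod_subset hsub fun j _ hj => ?_
    simp [not_not.1 (mt (hs j) hj)]
  have e1 : (-β) ^ k = ∏ j ∈ Icc 1 (n - k + 1), (-β) ^ v j := by
    rw [prod_pow_eq_pow_sum, h1]
  have e2 : (-(α * β)) ^ n = ∏ j ∈ Icc 1 (n - k + 1), (-(α * β)) ^ (j * v j) := by
    rw [prod_pow_eq_pow_sum, h2]
  rw [hw, e1, e2, ← prod_mul_distrib, ← prod_mul_distrib]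
  refine prod_congr rfl fun j hj => ?_
  obtain ⟨i, rfl⟩ := Nat.exists_eq_add_of_le' (mem_Icc.1 hj).1
  have hbase : -β * ((-1 : ℝ) ^ i * (Nat.factorial i : ℝ) * α ^ (i + 1) * β ^ i /
      (Nat.factorial (i + 1) : ℝ)) = (-(α * β)) ^ (i + 1) * ((i + 1 : ℕ) : ℝ)⁻¹ := by
    have hf : (Nat.factorial i : ℝ) ≠ 0 := by positivity
    have hi : (i : ℝ) + 1 ≠ 0 := by positivity
    rw [Nat.factorial_succ, neg_pow (α * β), mul_pow]
    push_cast
    field_simp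
    ring
  rw [Nat.add_sub_cancel, mul_left_comm, ← mul_pow, hbase, mul_pow, ← pow_mul, mul_inv, inv_pow]
  ring

/-- For real `α, β` and `n ≥ 1`:
`Σ_{k=1}^{n} (-β)^k B_{n,k}(0!·α, -1!·α²β, …, (-1)^{n-k}(n-k)!·α^{n-k+1}β^{n-k})
  = n!·(-αβ)^n`, where the `j`-th argument is `(-1)^{j-1}·(j-1)!·α^j·β^{j-1}`. -/
theorem bellB_identity (α β : ℝ) (n : ℕ) (hn : 1 ≤ n) :
    ∑ k ∈ Finset.Icc 1 n, (-β) ^ k *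
      bellB n k (fun j =>
        (-1 : ℝ) ^ (j - 1) * (Nat.factorial (j - 1) : ℝ) * α ^ j * β ^ (j - 1)) =
    (Nat.factorial n : ℝ) * (-(α * β)) ^ n := by
  have hmaps : ∀ v ∈ partMultiplicities n n,
      ∑ i ∈ Finset.Icc 1 n, v i ∈ Finset.Icc 1 n := by
    intro v hv
    rw [mem_partMultiplicities] at hv
    rw [Finset.mem_Icc, Nat.one_le_iff_ne_zero]
    constructor
    · intro h0
      have : ∑ j ∈ Finset.Icc 1 n, j * v j = 0 :=
        Finset.sum_eq_zero fun j hj => by rw [Finset.sum_eq_zero_iff.1 h0 j hj, mul_zero]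
      omega
    · conv_rhs => rw [← hv.2]
      exact Finset.sum_le_sum fun j hj => Nat.le_mul_of_pos_left _ (Finset.mem_Icc.1 hj).1
  calc _ = ∑ k ∈ Finset.Icc 1 n, (Nat.factorial n : ℝ) * (-(α * β)) ^ n *
        ∑ v ∈ partMultiplicities n n with ∑ i ∈ Finset.Icc 1 n, v i = k, cycleWeight n v := by
        refine Finset.sum_congr rfl fun k hk => ?_
        rw [bellB, mul_left_comm, mul_assoc, ← lambdaSet_eq_filter hk, Finset.mul_sum,
          Finset.mul_sum (a := (-(α * β)) ^ n)]
        exact congrArg _ (Finset.sum_congr rfl fun v hv =>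
          neg_pow_mul_prod_eq_cycleWeight α β hk hv)
    _ = (Nat.factorial n : ℝ) * (-(α * β)) ^ n := by
        rw [← Finset.mul_sum, Finset.sum_fiberwise_of_maps_to hmaps,
          sum_cycleWeight_eq_one le_rfl, mul_one]
end

section
/- Let α be a nonzero real number and let n ≥ 1 be an integer. Then Σ_{k=1}^{n} (1 − 1/α)_k · B_{n,k}((α)_1, (α)_2, …, (α)_{n−k+1}) = (α−1)_n, where the j-th argument of B_{n,k} is the falling factorial (α)_j. -/
/-- The falling factorial `(x)_k = x(x-1)(x-2)⋯(x-k+1)`, with `(x)_0 = 1`. -/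
def fallFac (x : ℝ) : ℕ → ℝ
  | 0 => 1
  | m + 1 => fallFac x m * (x - (m : ℝ))

open PowerSeries in
/-- Powers of power series without constant term, truncated: the coefficient of `X ^ (N + k)` in
`f ^ (k + 1)` depends only on the coefficients of `f` of index at most `N`. -/
theorem coeff_pow_succ_congr {R : Type*} [CommRing R] {f g : R⟦X⟧} {N : ℕ} (k : ℕ)
    (hf : constantCoeff f = 0) (hfg : ∀ m ≤ N, coeff m f = coeff m g) :
    coeff (N + k) (f ^ (k + 1)) = coeff (N + k) (g ^ (k + 1)) := by
  have hg : constantCoeff g = 0 := by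
    rw [← coeff_zero_eq_constantCoeff_apply, ← hfg 0 (Nat.zero_le _),
      coeff_zero_eq_constantCoeff_apply, hf]
  have hdiff : (X : R⟦X⟧) ^ (N + 1) ∣ f - g := by
    rw [X_pow_dvd_iff]
    intro m hm
    rw [map_sub, hfg m (by lia), sub_self]
  have hsum : (X : R⟦X⟧) ^ k ∣ ∑ i ∈ Finset.range (k + 1), f ^ i * g ^ (k + 1 - 1 - i) := by
    refine Finset.dvd_sum fun i hi => ?_
    have hik : i + (k + 1 - 1 - i) = k := by
      have := Finset.mem_range.1 hi
      lia
    calc (X : R⟦X⟧) ^ k = X ^ i * X ^ (k + 1 - 1 - i) := by rw [← pow_add, hik]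
      _ ∣ _ := mul_dvd_mul (pow_dvd_pow_of_dvd (X_dvd_iff.2 hf) _)
          (pow_dvd_pow_of_dvd (X_dvd_iff.2 hg) _)
  have h : (X : R⟦X⟧) ^ (k + (N + 1)) ∣ f ^ (k + 1) - g ^ (k + 1) := by
    rw [← (Commute.all f g).geom_sum₂_mul, pow_add]
    exact mul_dvd_mul hsum hdiff
  have := X_pow_dvd_iff.1 h (N + k) (by lia)
  rwa [map_sub, sub_eq_zero] at this

open PowerSeries in
/-- The vertical generating function of the partial exponential Bell polynomials. -/
theorem bellB_eq_coeff_pow {u : ℕ → ℝ} {f : ℝ⟦X⟧} (hf : constantCoeff f = 0)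
    (hu : ∀ j, 1 ≤ j → coeff j f = u j / (j.factorial : ℝ)) {n k : ℕ} (hk : 1 ≤ k) (hkn : k ≤ n) :
    bellB n k u = (n.factorial : ℝ) / (k.factorial : ℝ) * coeff n (f ^ k) := by
  set s := Finset.Icc 1 (n - k + 1) with hs
  set g : ℝ⟦X⟧ := ∑ j ∈ s, monomial j (u j / (j.factorial : ℝ)) with hg
  have hfg : ∀ m ≤ n - k + 1, coeff m f = coeff m g := by
    intro m hm
    rcases Nat.eq_zero_or_pos m with rfl | hm0
    · simp [hg, hf, coeff_monomial, hs]
    · have hms : m ∈ s := Finset.mem_Icc.2 ⟨hm0, hm⟩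
      simp [hg, coeff_monomial, hms, hu m hm0]
  have hpow : coeff n (f ^ k) = coeff n (g ^ k) := by
    have h := coeff_pow_succ_congr (k - 1) hf hfg
    rwa [show n - k + 1 + (k - 1) = n by lia, Nat.sub_add_cancel hk] at h
  have hterm : ∀ v : ℕ → ℕ, ∏ j ∈ s, (monomial j (u j / (j.factorial : ℝ)) : ℝ⟦X⟧) ^ v j =
      monomial (∑ j ∈ s, j * v j) (∏ j ∈ s, (u j / (j.factorial : ℝ)) ^ v j) := by
    intro v
    simp only [monomial_pow, prod_monomial, mul_comm]
  rw [hpow, hg, Finset.sum_pow_eq_sum_piAntidiag, map_sum, bellB, lambdaSet, Finset.sum_filter,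
    Finset.mul_sum, Finset.mul_sum]
  refine Finset.sum_congr rfl fun v hv => ?_
  have hvk : ∑ j ∈ s, v j = k := (Finset.mem_piAntidiag.1 hv).1
  have hmul : (∏ j ∈ s, ((v j).factorial : ℝ)) * (Nat.multinomial s v : ℝ) = k.factorial := by
    exact_mod_cast hvk ▸ Nat.multinomial_spec s v
  have hprod : (∏ j ∈ s, ((v j).factorial : ℝ)) ≠ 0 :=
    Finset.prod_ne_zero_iff.2 fun j _ => by positivity
  have hk0 : (k.factorial : ℝ) ≠ 0 := by positivity
  rw [hterm, ← nsmul_eq_mul (Nat.multinomial s v), map_nsmul, coeff_monomial, nsmul_eq_mul, ← hs]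
  by_cases h : ∑ j ∈ s, j * v j = n
  · rw [if_pos h, if_pos h.symm, Finset.prod_mul_distrib, Finset.prod_div_distrib,
      Finset.prod_const_one, ← hmul]
    rw [← hmul] at hk0
    have := right_ne_zero_of_mul hk0
    field_simp
  · rw [if_neg h, if_neg (Ne.symm h)]
    simp

theorem fallFac_eq_eval_descPochhammer (x : ℝ) (k : ℕ) :
    fallFac x k = (descPochhammer ℝ k).eval x := by
  induction k with
  | zero => simp [fallFac]
  | succ k ih => rw [fallFac, ih, descPochhammer_succ_eval]

theorem fallFac_natCast (m k : ℕ) : fallFac m k = (k.factorial : ℝ) * (m.choose k : ℝ) := by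
  rw [fallFac_eq_eval_descPochhammer, descPochhammer_eval_eq_descFactorial,
    Nat.descFactorial_eq_factorial_mul_choose, Nat.cast_mul]

theorem fallFac_eq_factorial_mul_choose (x : ℝ) (k : ℕ) :
    fallFac x k = (k.factorial : ℝ) * Ring.choose x k := by
  rw [← nsmul_eq_mul, ← Ring.descPochhammer_eq_factorial_smul_choose,
    fallFac_eq_eval_descPochhammer, ← descPochhammer_map (Int.castRingHom ℝ),
    ← Polynomial.aeval_eq_smeval, Polynomial.eval_map, Polynomial.aeval_def]
  rfl

theorem powerSeries_binomialSeries_natCast_mul (α : ℝ) (m : ℕ) :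
    PowerSeries.binomialSeries ℝ (m * α) = PowerSeries.binomialSeries ℝ α ^ m := by
  induction m with
  | zero => simp
  | succ m ih => rw [Nat.cast_succ, add_one_mul, PowerSeries.binomialSeries_add, ih, pow_succ]

open PowerSeries in
/-- The expansion of `(1 + f) ^ m`, with `f` free of constant term, up to order `n`. -/
theorem coeff_one_add_pow_eq_sum {R : Type*} [CommRing R] {f : R⟦X⟧} (hf : constantCoeff f = 0)
    (n m : ℕ) :
    coeff n ((1 + f) ^ m) = ∑ k ∈ Finset.range (n + 1), (m.choose k : R) * coeff n (f ^ k) := by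
  have h0 : ∀ k, n < k → coeff n (f ^ k) = 0 := fun k hk =>
    X_pow_dvd_iff.1 (pow_dvd_pow_of_dvd (X_dvd_iff.2 hf) k) n hk
  have hc : ∀ k, coeff n (f ^ k * (m.choose k : R⟦X⟧)) = (m.choose k : R) * coeff n (f ^ k) := by
    intro k
    rw [mul_comm, ← nsmul_eq_mul, map_nsmul, nsmul_eq_mul]
  rw [add_comm, add_pow, map_sum]
  simp only [one_pow, mul_one, hc]
  rw [Finset.sum_subset (Finset.range_mono (show m + 1 ≤ max m n + 1 by lia)),
    Finset.sum_subset (Finset.range_mono (show n + 1 ≤ max m n + 1 by lia))]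
  · intro k _ hk
    rw [h0 k (by simpa using hk), mul_zero]
  · intro k _ hk
    rw [Nat.choose_eq_zero_of_lt (by simpa using hk), Nat.cast_zero, zero_mul]

/-- The coefficient form of `((1 + X) ^ α) ^ β = (1 + X) ^ (β * α)`. -/
theorem sum_fallFac_mul_bellB (α β : ℝ) {n : ℕ} (hn : 1 ≤ n) :
    ∑ k ∈ Finset.Icc 1 n, fallFac β k * bellB n k (fun j => fallFac α j) = fallFac (β * α) n := by
  set P : Polynomial ℝ := ∑ k ∈ Finset.Icc 1 n,
    descPochhammer ℝ k * Polynomial.C (bellB n k fun j => fallFac α j) with hP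
  set Q : Polynomial ℝ := (descPochhammer ℝ n).comp (Polynomial.X * Polynomial.C α) with hQ
  have hPeval : ∀ x, P.eval x =
      ∑ k ∈ Finset.Icc 1 n, fallFac x k * bellB n k (fun j => fallFac α j) := fun x => by
    simp [hP, Polynomial.eval_finsetSum, fallFac_eq_eval_descPochhammer]
  have hQeval : ∀ x, Q.eval x = fallFac (x * α) n := fun x => by
    rw [hQ, fallFac_eq_eval_descPochhammer, Polynomial.eval_comp, Polynomial.eval_mul,
      Polynomial.eval_X, Polynomial.eval_C]
  suffices hPQ : P = Q by rw [← hPeval, ← hQeval, hPQ]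
  refine Polynomial.eq_of_infinite_eval_eq P Q
    ((Set.infinite_range_of_injective (Nat.cast_injective (R := ℝ))).mono ?_)
  rintro _ ⟨m, rfl⟩
  rw [Set.mem_ofPred_eq, hPeval, hQeval]
  set f : PowerSeries ℝ := PowerSeries.binomialSeries ℝ α - 1 with hf_def
  have hf : PowerSeries.constantCoeff f = 0 := by simp [hf_def]
  have hu : ∀ j, 1 ≤ j → PowerSeries.coeff j f = fallFac α j / (j.factorial : ℝ) := by
    intro j hj
    have : (j.factorial : ℝ) ≠ 0 := by positivity
    rw [fallFac_eq_factorial_mul_choose, mul_div_cancel_left₀ _ this, hf_def, map_sub,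
      PowerSeries.coeff_one, if_neg (by lia), PowerSeries.binomialSeries_coeff]
    simp
  have hcoeff : PowerSeries.coeff n (PowerSeries.binomialSeries ℝ ((m : ℝ) * α)) =
      ∑ k ∈ Finset.range (n + 1), (m.choose k : ℝ) * PowerSeries.coeff n (f ^ k) := by
    rw [powerSeries_binomialSeries_natCast_mul, ← coeff_one_add_pow_eq_sum hf, hf_def, add_sub_cancel]
  rw [PowerSeries.binomialSeries_coeff, smul_eq_mul, mul_one, Finset.sum_range_succ',
    pow_zero, PowerSeries.coeff_one, if_neg (by lia), mul_zero, add_zero] at hcoeff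
  rw [fallFac_eq_factorial_mul_choose, hcoeff, Finset.range_eq_Ico,
    Finset.sum_Ico_add' (fun k => (m.choose k : ℝ) * PowerSeries.coeff n (f ^ k)), zero_add,
    Finset.mul_sum]
  refine Finset.sum_congr (by ext; simp) fun k hk => ?_
  obtain ⟨hk1, hkn⟩ := Finset.mem_Icc.1 hk
  have : (k.factorial : ℝ) ≠ 0 := by positivity
  rw [bellB_eq_coeff_pow hf hu hk1 hkn, fallFac_natCast]
  field_simp

/-- For a nonzero real `α` and `n ≥ 1`:
`Σ_{k=1}^{n} (1 - 1/α)_k B_{n,k}((α)_1, (α)_2, …, (α)_{n-k+1}) = (α-1)_n`,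
where `(x)_k` is the falling factorial and the `j`-th argument is `(α)_j`. -/
theorem bellB_fallFac_identity (α : ℝ) (hα : α ≠ 0) (n : ℕ) (hn : 1 ≤ n) :
    ∑ k ∈ Finset.Icc 1 n, fallFac (1 - 1 / α) k * bellB n k (fun j => fallFac α j) =
      fallFac (α - 1) n := by
  rw [sum_fallFac_mul_bellB α _ hn, sub_mul, one_mul, one_div_mul_cancel hα]
end

section
/- Let n ≥ 2 be an integer. Regarding the complete exponential Bell polynomials as polynomials in the formal variables u_1, u_2, …, the following identity of polynomials holds: B_n(1!·u_1, 2!·u_2, …, n!·u_n) = u_1·B_{n−1}(1!·u_1, 2!·u_2, …, (n−1)!·u_{n−1}) + Σ_{k=1}^{n−1} (k+1)·u_{k+1}·∂/∂u_k [B_{n−1}(1!·u_1, 2!·u_2, …, (n−1)!·u_{n−1})], where ∂/∂u_k is the formal partial derivative with respect to u_k. -/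
/-- The `n`-th complete exponential Bell polynomial
`B_n(u_1, …, u_n) = Σ_{k=1}^{n} B_{n,k}(u_1, …, u_{n-k+1})`, as a multivariate polynomial. -/
noncomputable def completeBellP (n : ℕ) (u : ℕ → MvPolynomial ℕ ℚ) : MvPolynomial ℕ ℚ :=
  ∑ k ∈ Finset.Icc 1 n, bellP n k u

open Finsupp in
/-- The multi-indices of the monomials occurring in the partial Bell polynomials `B_{n,k}`. -/
lemma coe_mem_lambdaSet_iff_s17 (n k : ℕ) (d : ℕ →₀ ℕ) :
    (d : ℕ → ℕ) ∈ lambdaSet n k ↔ d 0 = 0 ∧ d.degree = k ∧ weight id d = n := by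
  have key : ∀ s : Finset ℕ, d.support ⊆ s →
      d.degree = ∑ j ∈ s, d j ∧ weight id d = ∑ j ∈ s, j * d j := by
    intro s hs
    refine ⟨Finset.sum_subset hs fun j _ hj => by simpa using hj, ?_⟩
    rw [weight_apply, Finsupp.sum_of_support_subset d hs _ (by simp)]
    simp [mul_comm]
  simp only [lambdaSet, Finset.mem_filter, Finset.mem_piAntidiag]
  constructor
  · rintro ⟨⟨hk, hs⟩, hn⟩
    have hs' : d.support ⊆ Finset.Icc 1 (n - k + 1) := fun j hj => hs j (by simpa using hj)
    obtain ⟨h1, h2⟩ := key _ hs'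
    refine ⟨by_contra fun h => ?_, h1.trans hk, h2.trans hn⟩
    simpa using hs 0 h
  · rintro ⟨h0, hk, hn⟩
    have hs' : d.support ⊆ Finset.Icc 1 (n - k + 1) := by
      intro j hj
      have hj' : d j ≠ 0 := by simpa using hj
      have hj0 : j ≠ 0 := by rintro rfl; exact hj' h0
      obtain ⟨h1, h2⟩ := key d.support subset_rfl
      have h3 : (∑ i ∈ d.support, d i) + (j - 1) ≤ ∑ i ∈ d.support, i * d i := by
        rw [← Finset.add_sum_erase _ _ hj, ← Finset.add_sum_erase _ (fun i => i * d i) hj]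
        have h4 : ∑ i ∈ d.support.erase j, d i ≤ ∑ i ∈ d.support.erase j, i * d i := by
          refine Finset.sum_le_sum fun i hi => Nat.le_mul_of_pos_left _ (Nat.pos_of_ne_zero ?_)
          rintro rfl
          simp [h0] at hi
        have h5 : d j + (j - 1) ≤ j * d j := by
          obtain ⟨i, rfl⟩ := Nat.exists_eq_succ_of_ne_zero hj0
          obtain ⟨m, hm⟩ := Nat.exists_eq_succ_of_ne_zero hj'
          rw [hm]
          simp only [Nat.succ_eq_add_one, Nat.add_sub_cancel]
          nlinarith [Nat.zero_le (i * m)]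
        omega
      simp only [Finset.mem_Icc]
      omega
    obtain ⟨h1, h2⟩ := key _ hs'
    exact ⟨⟨h1.symm.trans hk, fun j hj => hs' (by simpa using hj)⟩, h2.symm.trans hn⟩

open Finsupp MvPolynomial in
lemma coeff_bellP_factorial_smul_X (n k : ℕ) (d : ℕ →₀ ℕ) :
    coeff d (bellP n k fun j => (Nat.factorial j : ℚ) • X j) =
      if d 0 = 0 ∧ d.degree = k ∧ weight id d = n then
        (Nat.factorial n : ℚ) * (d.prod fun _ m => (Nat.factorial m : ℚ))⁻¹ else 0 := by
  classical
  have hmon : ∀ v : ℕ → ℕ, (∏ j ∈ Finset.Icc 1 (n - k + 1),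
      ((Nat.factorial (v j) : ℚ) * (Nat.factorial j : ℚ) ^ (v j))⁻¹ •
        ((Nat.factorial j : ℚ) • (X j : MvPolynomial ℕ ℚ)) ^ (v j)) =
      monomial (∑ j ∈ Finset.Icc 1 (n - k + 1), single j (v j))
        (∏ j ∈ Finset.Icc 1 (n - k + 1), (Nat.factorial (v j) : ℚ)⁻¹) := by
    intro v
    rw [monomial_sum_prod]
    refine Finset.prod_congr rfl fun j _ => ?_
    have hj : (Nat.factorial j : ℚ) ≠ 0 := by exact_mod_cast Nat.factorial_ne_zero j
    rw [smul_pow, smul_smul, X_pow_eq_monomial, smul_monomial, smul_eq_mul, mul_one, mul_inv,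
      mul_assoc, inv_mul_cancel₀ (pow_ne_zero _ hj), mul_one]
  have hsupp : ∀ v ∈ lambdaSet n k, ∀ i, v i ≠ 0 → i ∈ Finset.Icc 1 (n - k + 1) := by
    intro v hv
    exact (Finset.mem_piAntidiag.1 (Finset.mem_filter.1 hv).1).2
  have hexp : ∀ v ∈ lambdaSet n k,
      (∑ j ∈ Finset.Icc 1 (n - k + 1), single j (v j) = d ↔ v = d) := by
    intro v hv
    rw [DFunLike.ext'_iff]
    have : ⇑(∑ j ∈ Finset.Icc 1 (n - k + 1), single j (v j)) = v := by
      funext i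
      rw [Finsupp.finsetSum_apply]
      simp only [single_apply, Finset.sum_ite_eq']
      split_ifs with h
      · rfl
      · exact (not_not.1 fun h' => h (hsupp v hv i h')).symm
    rw [this]
  rw [bellP, coeff_smul, coeff_sum]
  simp only [← coe_mem_lambdaSet_iff_s17, hmon, coeff_monomial]
  rw [Finset.sum_congr rfl fun v hv => if_congr (hexp v hv) rfl rfl, Finset.sum_ite_eq']
  split_ifs with h
  · rw [Finsupp.prod_of_support_subset d (fun j hj => hsupp _ h j (by simpa using hj)) _
      (by simp), Finset.prod_inv_distrib, smul_eq_mul]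
  · simp

open Finsupp MvPolynomial in
lemma coeff_completeBellP_factorial_smul_X {n : ℕ} (hn : n ≠ 0) (d : ℕ →₀ ℕ) :
    coeff d (completeBellP n fun j => (Nat.factorial j : ℚ) • X j) =
      if d 0 = 0 ∧ weight id d = n then
        (Nat.factorial n : ℚ) * (d.prod fun _ m => (Nat.factorial m : ℚ))⁻¹ else 0 := by
  simp only [completeBellP, coeff_sum, coeff_bellP_factorial_smul_X]
  split_ifs with h
  · obtain ⟨h0, hw⟩ := h
    have hle : d.degree ≤ n := by
      rw [← hw, weight_apply, Finsupp.sum, Finsupp.degree_apply]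
      refine Finset.sum_le_sum fun i hi => Nat.le_mul_of_pos_right _ (Nat.pos_of_ne_zero ?_)
      rintro rfl
      simp [h0] at hi
    have hpos : d.degree ≠ 0 := by
      rw [Ne, degree_eq_zero_iff]
      rintro rfl
      simp at hw
      exact hn hw.symm
    rw [Finset.sum_eq_single_of_mem d.degree
      (Finset.mem_Icc.2 ⟨Nat.one_le_iff_ne_zero.2 hpos, hle⟩)]
    · simp [h0, hw]
    · intro k _ hk
      simp [hk.symm]
  · refine Finset.sum_eq_zero fun k _ => if_neg ?_
    tauto

open Finsupp in
lemma prod_factorial_add_single_one (d : ℕ →₀ ℕ) (k : ℕ) :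
    ((d + single k 1).prod fun _ m => (Nat.factorial m : ℚ)) =
      (d k + 1) * d.prod fun _ m => (Nat.factorial m : ℚ) := by
  classical
  have hk : k ∈ insert k d.support := Finset.mem_insert_self _ _
  rw [Finsupp.prod_of_support_subset (d + single k 1) (s := insert k d.support) ?_ _ (by simp),
    Finsupp.prod_of_support_subset d (Finset.subset_insert k _) _ (by simp),
    ← Finset.mul_prod_erase _ _ hk,
    ← Finset.mul_prod_erase _ (fun i => (Nat.factorial (d i) : ℚ)) hk, ← mul_assoc]
  · congr 1
    · simp [Nat.factorial_succ]
    · refine Finset.prod_congr rfl fun i hi => ?_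
      simp [(Finset.ne_of_mem_erase hi).symm]
  · intro i hi
    by_contra h
    simp only [Finset.mem_insert, not_or, mem_support_iff, not_not] at h
    simp [h.2, Ne.symm h.1] at hi

open Finsupp in
lemma inv_prod_factorial_eq (d : ℕ →₀ ℕ) (k : ℕ) :
    (d.prod fun _ m => (Nat.factorial m : ℚ))⁻¹ =
      (d k + 1) * ((d + single k 1).prod fun _ m => (Nat.factorial m : ℚ))⁻¹ := by
  have h : (d k + 1 : ℚ) ≠ 0 := by positivity
  rw [prod_factorial_add_single_one, mul_inv, mul_inv_cancel_left₀ h]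

open Finsupp MvPolynomial in
lemma coeff_X_one_mul_completeBellP {n : ℕ} (hn : n ≠ 0) (d : ℕ →₀ ℕ) :
    coeff d (X 1 * completeBellP n fun j => (Nat.factorial j : ℚ) • X j) =
      (if d 0 = 0 ∧ weight id d = n + 1 then
        (Nat.factorial n : ℚ) * (d.prod fun _ m => (Nat.factorial m : ℚ))⁻¹ else 0) * d 1 := by
  classical
  rw [coeff_X_mul']
  by_cases h1 : 1 ∈ d.support
  · obtain ⟨e, rfl⟩ : ∃ e, d = e + single 1 1 :=
      ⟨d - single 1 1, (sub_add_single_one_cancel (by simpa using h1)).symm⟩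
    rw [if_pos h1, add_tsub_cancel_right, coeff_completeBellP_factorial_smul_X hn]
    have hiff : (e 0 = 0 ∧ weight id e = n) ↔
        ((e + single 1 1 : ℕ →₀ ℕ) 0 = 0 ∧ weight id (e + single 1 1) = n + 1) := by
      simp [weight_single]
    simp only [hiff]
    split_ifs with h2
    · rw [inv_prod_factorial_eq e 1]
      simp only [Finsupp.add_apply, single_eq_same]
      push_cast
      ring
    · simp
  · have : d 1 = 0 := by simpa using h1
    simp [this]

open Finsupp MvPolynomial in
lemma coeff_X_succ_mul_pderiv_completeBellP {n k : ℕ} (hn : n ≠ 0) (hk : k ≠ 0) (d : ℕ →₀ ℕ) :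
    coeff d (X (k + 1) *
        pderiv k (completeBellP n fun j => (Nat.factorial j : ℚ) • X j)) =
      (if d 0 = 0 ∧ weight id d = n + 1 then
        (Nat.factorial n : ℚ) * (d.prod fun _ m => (Nat.factorial m : ℚ))⁻¹ else 0) *
        d (k + 1) := by
  classical
  rw [coeff_X_mul']
  by_cases h1 : k + 1 ∈ d.support
  · obtain ⟨e, rfl⟩ : ∃ e, d = e + single (k + 1) 1 :=
      ⟨d - single (k + 1) 1, (sub_add_single_one_cancel (by simpa using h1)).symm⟩
    rw [if_pos h1, add_tsub_cancel_right, coeff_pderiv, coeff_completeBellP_factorial_smul_X hn]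
    have hiff : ((e + single k 1 : ℕ →₀ ℕ) 0 = 0 ∧ weight id (e + single k 1) = n) ↔
        ((e + single (k + 1) 1 : ℕ →₀ ℕ) 0 = 0 ∧
          weight id (e + single (k + 1) 1) = n + 1) := by
      simp [weight_single, hk, ← add_assoc]
    simp only [hiff]
    split_ifs with h2
    · have := inv_prod_factorial_eq e k
      rw [mul_assoc, mul_comm _ ((e k : ℚ) + 1), ← this, inv_prod_factorial_eq e (k + 1)]
      simp only [Finsupp.add_apply, single_eq_same]
      push_cast
      ring
    · simp
  · have : d (k + 1) = 0 := by simpa using h1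
    simp [this]

/-- For `n ≥ 2`, as an identity of polynomials in the formal variables `u_k = X k`:
`B_n(1!·u_1, …, n!·u_n)
  = u_1·B_{n-1}(1!·u_1, …, (n-1)!·u_{n-1})
    + Σ_{k=1}^{n-1} (k+1)·u_{k+1}·∂/∂u_k [B_{n-1}(1!·u_1, …, (n-1)!·u_{n-1})]`. -/
theorem completeBellP_pderiv_recurrence (n : ℕ) (hn : 2 ≤ n) :
    completeBellP n (fun j => (Nat.factorial j : ℚ) • MvPolynomial.X j) =
      MvPolynomial.X 1 *
        completeBellP (n - 1) (fun j => (Nat.factorial j : ℚ) • MvPolynomial.X j) +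
      ∑ k ∈ Finset.Icc 1 (n - 1), ((k : ℚ) + 1) •
        (MvPolynomial.X (k + 1) *
          MvPolynomial.pderiv k
            (completeBellP (n - 1) (fun j => (Nat.factorial j : ℚ) • MvPolynomial.X j))) := by
  obtain ⟨m, rfl⟩ : ∃ m, n = m + 1 := ⟨n - 1, by omega⟩
  have hm : m ≠ 0 := by omega
  ext d
  rw [Nat.add_sub_cancel, MvPolynomial.coeff_add, MvPolynomial.coeff_sum,
    coeff_X_one_mul_completeBellP hm, coeff_completeBellP_factorial_smul_X (by omega : m + 1 ≠ 0)]
  have hterm : ∀ k ∈ Finset.Icc 1 m, MvPolynomial.coeff d (((k : ℚ) + 1) •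
      (MvPolynomial.X (k + 1) * MvPolynomial.pderiv k
        (completeBellP m (fun j => (Nat.factorial j : ℚ) • MvPolynomial.X j)))) =
      (if d 0 = 0 ∧ Finsupp.weight id d = m + 1 then
        (Nat.factorial m : ℚ) * (d.prod fun _ m => (Nat.factorial m : ℚ))⁻¹ else 0) *
        (((k + 1 : ℕ) : ℚ) * d (k + 1)) := by
    intro k hk
    rw [MvPolynomial.coeff_smul, coeff_X_succ_mul_pderiv_completeBellP hm
      (Nat.one_le_iff_ne_zero.1 (Finset.mem_Icc.1 hk).1), smul_eq_mul]
    push_cast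
    ring
  rw [Finset.sum_congr rfl hterm, ← Finset.mul_sum, ← mul_add]
  split_ifs with h
  · obtain ⟨h0, hw⟩ := h
    have hsub : d.support ⊆ Finset.range (m + 2) := by
      intro j hj
      have hle : id j ≤ Finsupp.weight id d :=
        Finsupp.le_weight_of_ne_zero' id (Finsupp.mem_support_iff.1 hj)
      rw [hw, id] at hle
      exact Finset.mem_range.2 (by omega)
    have hsum : ((m + 1 : ℕ) : ℚ) = d 1 + ∑ k ∈ Finset.Icc 1 m, ((k + 1 : ℕ) : ℚ) * d (k + 1) := by
      rw [← hw, Finsupp.weight_apply, Finsupp.sum_of_support_subset d hsub _ (by simp)]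
      rw [Finset.sum_range_succ', Finset.sum_range_succ', Finset.range_eq_Ico,
        Finset.sum_Ico_add' (fun k => d (k + 1) • id (k + 1)) 0 m 1]
      have : Finset.Ico (0 + 1) (m + 1) = Finset.Icc 1 m := rfl
      rw [this]
      push_cast
      simp [mul_comm, add_comm]
    rw [← hsum, Nat.factorial_succ]
    push_cast
    ring
  · simp
end

section
/- Let n ≥ 2 be an integer. Then: (i) for real numbers u_1, …, u_n, B̂_n(u_1, u_2, …, u_n) = (1/n) Σ_{k=0}^{n−1} (k+1)·u_{k+1}·B̂_{n−k−1}(u_1, u_2, …, u_{n−k−1}), with the convention B̂_0 = 1; and (ii) as an identity of polynomials in the formal variables u_1, u_2, …, B̂_n(u_1, u_2, …, u_n) = (u_1/n)·B̂_{n−1}(u_1, u_2, …, u_{n−1}) + (1/n) Σ_{k=1}^{n−1} (k+1)·u_{k+1}·∂/∂u_k [B̂_{n−1}(u_1, u_2, …, u_{n−1})], where ∂/∂u_k is the formal partial derivative with respect to u_k. -/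
/-- The `n`-th complete ordinary Bell polynomial
`B̂_n(u_1, …, u_n) = Σ_{k=1}^{n} (1/k!) B̂_{n,k}(u_1, …, u_{n-k+1})`, with `B̂_0 = 1`. -/
noncomputable def completeBellBhat (n : ℕ) (u : ℕ → ℝ) : ℝ :=
  if n = 0 then 1 else
    ∑ k ∈ Finset.Icc 1 n, (1 / (Nat.factorial k : ℝ)) * bellBhat n k u

/-- The `n`-th complete ordinary Bell polynomial, as a multivariate polynomial. -/
noncomputable def completeBellPhat (n : ℕ) (u : ℕ → MvPolynomial ℕ ℚ) : MvPolynomial ℕ ℚ :=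
  ∑ k ∈ Finset.Icc 1 n, (Nat.factorial k : ℚ)⁻¹ • bellPhat n k u

open MvPolynomial in
theorem coeff_X_mul_pderiv {σ R : Type*} [CommSemiring R] (i : σ) (p : MvPolynomial σ R)
    (d : σ →₀ ℕ) : coeff d (X i * pderiv i p) = d i * coeff d p := by
  classical
  rw [coeff_X_mul']
  split_ifs with h
  · have h1 : 1 ≤ d i := Nat.one_le_iff_ne_zero.2 (Finsupp.mem_support_iff.1 h)
    have h2 : d - Finsupp.single i 1 + Finsupp.single i 1 = d :=
      tsub_add_cancel_of_le (Finsupp.single_le_iff.2 h1)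
    rw [coeff_pderiv, h2, mul_comm]
    congr 1
    rw [Finsupp.tsub_apply, Finsupp.single_eq_same]
    exact_mod_cast congrArg (Nat.cast (R := R)) (Nat.sub_add_cancel h1)
  · rw [Finsupp.notMem_support_iff.1 h]
    simp

open MvPolynomial in
theorem prod_smul_X_pow_eq_monomial {σ R : Type*} [CommSemiring R] (s : Finset σ)
    (c : σ → R) (d : σ →₀ ℕ) (hd : d.support ⊆ s) :
    ∏ j ∈ s, c j • (X j : MvPolynomial σ R) ^ d j = monomial d (∏ j ∈ s, c j) := by
  rw [monomial_eq, Finsupp.prod_of_support_subset d hd _ (by simp), map_prod,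
    ← Finset.prod_mul_distrib]
  simp [smul_eq_C_mul]

theorem mem_lambdaSet_iff {n k : ℕ} (hk : k ∈ Finset.Icc 1 n) (d : ℕ →₀ ℕ) :
    ⇑d ∈ lambdaSet n k ↔ (d 0 = 0 ∧ Finsupp.weight id d = n) ∧ d.degree = k := by
  obtain ⟨hk1, hkn⟩ := Finset.mem_Icc.1 hk
  have sums (s : Finset ℕ) (hs : d.support ⊆ s) :
      d.degree = ∑ j ∈ s, d j ∧ Finsupp.weight id d = ∑ j ∈ s, j * d j := by
    refine ⟨Finset.sum_subset hs (by simp), ?_⟩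
    rw [Finsupp.weight_apply, Finsupp.sum_of_support_subset d hs _ (by simp)]
    simp [mul_comm]
  simp only [lambdaSet, Finset.mem_filter, Finset.mem_piAntidiag]
  constructor
  · rintro ⟨⟨h1, h2⟩, h3⟩
    have hs : d.support ⊆ Finset.Icc 1 (n - k + 1) := fun j hj =>
      h2 j (Finsupp.mem_support_iff.1 hj)
    obtain ⟨e1, e2⟩ := sums _ hs
    refine ⟨⟨?_, e2.trans h3⟩, e1.trans h1⟩
    by_contra h0
    simpa using h2 0 h0
  · rintro ⟨⟨h0, hw⟩, hdeg⟩
    have hs : d.support ⊆ Finset.Icc 1 (n - k + 1) := by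
      intro j hj
      have hj0 : d j ≠ 0 := Finsupp.mem_support_iff.1 hj
      have hj1 : 1 ≤ j := Nat.one_le_iff_ne_zero.2 (by rintro rfl; exact hj0 h0)
      refine Finset.mem_Icc.2 ⟨hj1, ?_⟩
      obtain ⟨e1, e2⟩ := sums d.support subset_rfl
      rw [← Finset.add_sum_erase _ _ hj] at e1 e2
      have hle : ∑ i ∈ d.support.erase j, d i ≤ ∑ i ∈ d.support.erase j, i * d i := by
        refine Finset.sum_le_sum fun i hi => Nat.le_mul_of_pos_left _ (Nat.pos_of_ne_zero ?_)
        rintro rfl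
        exact Finsupp.mem_support_iff.1 (Finset.mem_of_mem_erase hi) h0
      obtain ⟨a, rfl⟩ := Nat.exists_eq_add_of_le' hj1
      have : a ≤ a * d (a + 1) := Nat.le_mul_of_pos_right _ (Nat.pos_of_ne_zero hj0)
      have : (a + 1) * d (a + 1) = a * d (a + 1) + d (a + 1) := by ring
      omega
    obtain ⟨e1, e2⟩ := sums _ hs
    exact ⟨⟨e1.symm.trans hdeg, fun j hj => hs (Finsupp.mem_support_iff.2 hj)⟩,
      e2.symm.trans hw⟩

/-- The complete ordinary Bell polynomials in the variables `X j`, with value `1` at `n = 0`. -/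
noncomputable def bellPoly (n : ℕ) : MvPolynomial ℕ ℚ :=
  if n = 0 then 1 else completeBellPhat n (fun j => MvPolynomial.X j)

open Classical in
theorem coeff_bellPhat {n k : ℕ} (d : ℕ →₀ ℕ) :
    MvPolynomial.coeff d (bellPhat n k (fun j => MvPolynomial.X j)) =
      if ⇑d ∈ lambdaSet n k then
        (k.factorial : ℚ) * d.prod (fun _ m => (m.factorial : ℚ)⁻¹) else 0 := by
  have key : ∀ v ∈ lambdaSet n k,
      MvPolynomial.coeff d (∏ j ∈ Finset.Icc 1 (n - k + 1),
        ((v j).factorial : ℚ)⁻¹ • (MvPolynomial.X j : MvPolynomial ℕ ℚ) ^ v j) =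
      if ⇑d = v then d.prod (fun _ m => (m.factorial : ℚ)⁻¹) else 0 := by
    intro v hv
    have hsupp : ∀ j, v j ≠ 0 → j ∈ Finset.Icc 1 (n - k + 1) :=
      (Finset.mem_piAntidiag.1 (Finset.mem_filter.1 hv).1).2
    obtain ⟨e, rfl⟩ : ∃ e : ℕ →₀ ℕ, ⇑e = v := ⟨Finsupp.onFinset _ v hsupp, rfl⟩
    have he : e.support ⊆ Finset.Icc 1 (n - k + 1) := fun j hj =>
      hsupp j (Finsupp.mem_support_iff.1 hj)
    rw [prod_smul_X_pow_eq_monomial _ (fun j => ((e j).factorial : ℚ)⁻¹) e he,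
      MvPolynomial.coeff_monomial]
    by_cases hde : d = e
    · subst hde
      simp [Finsupp.prod_of_support_subset d he]
    · rw [if_neg (Ne.symm hde), if_neg (fun h => hde (DFunLike.coe_injective h))]
  rw [bellPhat, MvPolynomial.coeff_smul, MvPolynomial.coeff_sum, Finset.sum_congr rfl key,
    Finset.sum_ite_eq]
  split_ifs <;> simp

theorem coeff_bellPoly (n : ℕ) (d : ℕ →₀ ℕ) :
    MvPolynomial.coeff d (bellPoly n) =
      if d 0 = 0 ∧ Finsupp.weight id d = n then
        d.prod (fun _ m => (m.factorial : ℚ)⁻¹) else 0 := by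
  classical
  have hzero (h0 : d 0 = 0) (hd : d.degree = 0 ∨ Finsupp.weight id d = 0) : d = 0 := by
    rcases hd with hd | hd
    · exact (Finsupp.degree_eq_zero_iff d).1 hd
    · ext j
      by_contra hj
      have hj' : d j ≠ 0 := hj
      rw [Finsupp.weight_apply, Finsupp.sum, Finset.sum_eq_zero_iff] at hd
      have := hd j (Finsupp.mem_support_iff.2 hj')
      simp only [id, smul_eq_mul, mul_eq_zero, hj', false_or] at this
      exact hj' (this ▸ h0)
  rcases eq_or_ne n 0 with rfl | hn
  · rw [bellPoly, if_pos rfl, MvPolynomial.coeff_one]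
    by_cases hd : d = 0
    · subst hd
      simp
    · rw [if_neg (Ne.symm hd), if_neg fun h => hd (hzero h.1 (Or.inr h.2))]
  · rw [bellPoly, if_neg hn, completeBellPhat, MvPolynomial.coeff_sum]
    have key : ∀ k ∈ Finset.Icc 1 n, MvPolynomial.coeff d
        ((k.factorial : ℚ)⁻¹ • bellPhat n k (fun j => MvPolynomial.X j)) =
        if d.degree = k then (if d 0 = 0 ∧ Finsupp.weight id d = n then
          d.prod (fun _ m => (m.factorial : ℚ)⁻¹) else 0) else 0 := by
      intro k hk
      have hkf : (k.factorial : ℚ) ≠ 0 := by exact_mod_cast k.factorial_ne_zero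
      rw [MvPolynomial.coeff_smul, coeff_bellPhat, if_congr (mem_lambdaSet_iff hk d) rfl rfl]
      by_cases h1 : d.degree = k <;> by_cases h2 : d 0 = 0 ∧ Finsupp.weight id d = n
      · rw [if_pos ⟨h2, h1⟩, if_pos h1, if_pos h2, smul_eq_mul, inv_mul_cancel_left₀ hkf]
      all_goals simp only [h1, h2, and_false, and_true, if_false, if_true, smul_zero]
    rw [Finset.sum_congr rfl key, Finset.sum_ite_eq]
    split_ifs with h1 h2 h2
    · rfl
    · rfl
    · exfalso
      apply h1
      rw [Finset.mem_Icc]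
      constructor
      · refine Nat.one_le_iff_ne_zero.2 fun h => hn ?_
        rw [← h2.2, hzero h2.1 (Or.inl h), map_zero]
      · rw [← h2.2, Finsupp.weight_apply]
        refine Finset.sum_le_sum fun i hi => Nat.le_mul_of_pos_right _ (Nat.pos_of_ne_zero ?_)
        rintro h
        have h : i = 0 := h
        exact Finsupp.mem_support_iff.1 hi (h ▸ h2.1)
    · rfl

theorem pderiv_bellPoly {n k : ℕ} (hk : k ≠ 0) (hkn : k ≤ n) :
    MvPolynomial.pderiv k (bellPoly n) = bellPoly (n - k) := by
  classical
  ext d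
  rw [MvPolynomial.coeff_pderiv, coeff_bellPoly, coeff_bellPoly]
  have hiff : ((d + Finsupp.single k 1 : ℕ →₀ ℕ) 0 = 0 ∧ Finsupp.weight id (d + Finsupp.single k 1) = n) ↔
      (d 0 = 0 ∧ Finsupp.weight id d = n - k) := by
    rw [map_add, Finsupp.weight_single, Finsupp.add_apply, Finsupp.single_eq_of_ne hk.symm]
    simp only [id, one_smul]
    omega
  rw [if_congr hiff rfl rfl, ite_mul, zero_mul]
  congr 1
  have h1 : (d + Finsupp.single k 1).support ⊆ insert k d.support := by
    intro j hj
    by_cases hjk : j = k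
    · simp [hjk]
    · simpa [Finsupp.single_apply, Ne.symm hjk, hjk] using hj
  rw [Finsupp.prod_of_support_subset _ h1 _ (by simp),
    Finsupp.prod_of_support_subset d (Finset.subset_insert k d.support) _ (by simp),
    ← Finset.mul_prod_erase _ _ (Finset.mem_insert_self k d.support),
    ← Finset.mul_prod_erase _ (fun j => ((d j).factorial : ℚ)⁻¹)
      (Finset.mem_insert_self k d.support)]
  have h2 : ∀ j ∈ (insert k d.support).erase k,
      (((d + Finsupp.single k 1 : ℕ →₀ ℕ) j).factorial : ℚ)⁻¹ = ((d j).factorial : ℚ)⁻¹ := by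
    intro j hj
    rw [Finsupp.add_apply, Finsupp.single_eq_of_ne (Finset.ne_of_mem_erase hj), add_zero]
  rw [Finset.prod_congr rfl h2, Finsupp.add_apply, Finsupp.single_eq_same, Nat.factorial_succ]
  have h3 : ((d k).factorial : ℚ) ≠ 0 := by exact_mod_cast (d k).factorial_ne_zero
  push_cast
  field_simp

theorem natCast_smul_bellPoly (n : ℕ) :
    (n : ℚ) • bellPoly n = ∑ k ∈ Finset.range n,
      ((k : ℚ) + 1) • (MvPolynomial.X (k + 1) * bellPoly (n - k - 1)) := by
  have hD : ∀ k ∈ Finset.range n,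
      ((k : ℚ) + 1) • (MvPolynomial.X (k + 1) * bellPoly (n - k - 1)) =
      ((k : ℚ) + 1) • (MvPolynomial.X (k + 1) * MvPolynomial.pderiv (k + 1) (bellPoly n)) := by
    intro k hk
    rw [pderiv_bellPoly k.succ_ne_zero (Finset.mem_range.1 hk), Nat.sub_sub]
  rw [Finset.sum_congr rfl hD]
  ext d
  simp only [MvPolynomial.coeff_sum, MvPolynomial.coeff_smul, coeff_X_mul_pderiv, smul_eq_mul,
    ← mul_assoc, ← Finset.sum_mul]
  rw [coeff_bellPoly]
  split_ifs with h
  · obtain ⟨h0, hw⟩ := h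
    congr 1
    have hs : d.support ⊆ Finset.range (n + 1) := by
      intro j hj
      rw [Finset.mem_range, Nat.lt_succ_iff, ← hw]
      exact Finsupp.le_weight_of_ne_zero' id (Finsupp.mem_support_iff.1 hj)
    have hsum : ∑ j ∈ Finset.range (n + 1), d j * j = n := by
      rw [Finsupp.weight_apply, Finsupp.sum_of_support_subset d hs _ (by simp)] at hw
      simpa using hw
    rw [Finset.sum_range_succ', mul_zero, add_zero] at hsum
    nth_rewrite 1 [← hsum]
    push_cast
    exact Finset.sum_congr rfl fun _ _ => mul_comm _ _
  · simp

theorem aeval_bellPoly (n : ℕ) (u : ℕ → ℝ) :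
    MvPolynomial.aeval u (bellPoly n) = completeBellBhat n u := by
  rw [bellPoly, completeBellBhat]
  split_ifs
  · simp
  · simp [completeBellPhat, bellPhat, bellBhat, Algebra.smul_def, div_eq_inv_mul]

/-- For `n ≥ 2`:
(i) for real `u_1, …, u_n`,
`B̂_n(u_1, …, u_n) = (1/n) Σ_{k=0}^{n-1} (k+1)·u_{k+1}·B̂_{n-k-1}(u_1, …, u_{n-k-1})`
with the convention `B̂_0 = 1`; and
(ii) as an identity of polynomials in the formal variables `u_k = X k`,
`B̂_n(u_1, …, u_n) = (u_1/n)·B̂_{n-1}(u_1, …, u_{n-1})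
  + (1/n) Σ_{k=1}^{n-1} (k+1)·u_{k+1}·∂/∂u_k [B̂_{n-1}(u_1, …, u_{n-1})]`. -/
theorem completeBellBhat_recurrences (n : ℕ) (hn : 2 ≤ n) :
    (∀ u : ℕ → ℝ,
      completeBellBhat n u =
        (1 / (n : ℝ)) * ∑ k ∈ Finset.range n,
          ((k : ℝ) + 1) * u (k + 1) * completeBellBhat (n - k - 1) u) ∧
    (completeBellPhat n (fun j => MvPolynomial.X j) =
      ((n : ℚ))⁻¹ •
        (MvPolynomial.X 1 * completeBellPhat (n - 1) (fun j => MvPolynomial.X j)) +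
      ((n : ℚ))⁻¹ • ∑ k ∈ Finset.Icc 1 (n - 1), ((k : ℚ) + 1) •
        (MvPolynomial.X (k + 1) *
          MvPolynomial.pderiv k (completeBellPhat (n - 1) (fun j => MvPolynomial.X j)))) := by
  have hn0 : n ≠ 0 := by omega
  have hq : (n : ℚ) ≠ 0 := by exact_mod_cast hn0
  have hr : (n : ℝ) ≠ 0 := by exact_mod_cast hn0
  constructor
  · intro u
    have h := congrArg (MvPolynomial.aeval u) (natCast_smul_bellPoly n)
    simp only [map_sum, map_mul, MvPolynomial.aeval_X, aeval_bellPoly,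
      Algebra.smul_def, map_add, map_natCast, map_one, ← mul_assoc] at h
    rw [← h]
    field_simp
  · have e (m : ℕ) (hm : m ≠ 0) :
        completeBellPhat m (fun j => MvPolynomial.X j) = bellPoly m := (if_neg hm).symm
    rw [e n hn0, e (n - 1) (by omega), ← smul_add, eq_inv_smul_iff₀ hq, natCast_smul_bellPoly]
    obtain ⟨m, rfl⟩ := Nat.exists_eq_add_of_le' (show 1 ≤ n by omega)
    rw [Finset.sum_range_succ', add_comm]
    simp only [Nat.add_sub_cancel, Nat.cast_zero, zero_add, one_smul, Nat.sub_zero]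
    congr 1
    rw [← Finset.Ico_add_one_right_eq_Icc, Finset.sum_Ico_eq_sum_range, Nat.add_sub_cancel]
    refine Finset.sum_congr rfl fun k hk => ?_
    have hk' := Finset.mem_range.1 hk
    rw [add_comm 1 k, pderiv_bellPoly k.succ_ne_zero hk',
      show m + 1 - (k + 1) - 1 = m - (k + 1) by omega]
end
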